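/- arXiv:1406.2834 — 9 statements merged into one kernel-verified Lean document; each statement's English description precedes it below -/
import Mathlib

section
/- Let X be a nonempty finite set, P : X → ℝ a probability distribution with P(x) > 0 for all x, and J : X → ℝ a function with ∑_x J(x) = 0. Then the reversed divergence has the same quadratic local behavior as the forward one: the function ε ↦ (∑_x (P(x) + ε·J(x)) · Real.log ((P(x) + ε·J(x)) / P(x))) / ε² tends to (1/2) ∑_x J(x)²/P(x) as ε tends to 0 within the punctured neighborhood of 0. In particular D(P‖P+εJ) and D(P+εJ‖P) agree up to first order, both equal to (1/2)ε² ∑_x J(x)²/P(x) + o(ε²). -/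
open Filter Topology in
/-- Second-order expansion of `u ↦ u * log u` at `1` along the direction `a`. -/
theorem tendsto_mul_log_one_add_sub_div_sq (a : ℝ) :
    Tendsto (fun ε : ℝ => ((1 + ε * a) * Real.log (1 + ε * a) - ε * a) / ε ^ 2)
      (𝓝[≠] 0) (𝓝 (a ^ 2 / 2)) := by
  have hlin (ε : ℝ) : HasDerivAt (fun ε : ℝ => 1 + ε * a) a ε := by
    simpa using ((hasDerivAt_id ε).mul_const a).const_add 1
  have hcont : Continuous fun ε : ℝ => 1 + ε * a := by fun_prop
  have hpos : ∀ᶠ ε : ℝ in 𝓝[≠] 0, 0 < 1 + ε * a :=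
    (hcont.continuousAt.eventually (lt_mem_nhds (by simp))).filter_mono nhdsWithin_le_nhds
  refine HasDerivAt.lhopital_zero_nhdsNE (f' := fun ε => a * Real.log (1 + ε * a))
    (g' := fun ε => 2 * ε) ?_ ?_ ?_ ?_ ?_ ?_
  · filter_upwards [hpos] with ε hε
    have h := ((hlin ε).mul ((hlin ε).log hε.ne')).sub ((hasDerivAt_id ε).mul_const a)
    convert! h using 1
    rw [mul_div_cancel₀ a hε.ne']
    ring
  · exact Eventually.of_forall fun ε => by simpa using hasDerivAt_pow 2 ε
  · filter_upwards [self_mem_nhdsWithin] with ε hε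
    exact mul_ne_zero two_ne_zero hε
  · have h : ContinuousAt
        (fun ε : ℝ => (1 + ε * a) * Real.log (1 + ε * a) - ε * a) 0 := by
      fun_prop (disch := simp)
    simpa using h.tendsto.mono_left nhdsWithin_le_nhds
  · have h : Continuous fun ε : ℝ => ε ^ 2 := by fun_prop
    simpa using (h.tendsto 0).mono_left nhdsWithin_le_nhds
  · have h := hasDerivAt_iff_tendsto_slope.1 ((hlin 0).log (by simp))
    convert! h.const_mul (a / 2) using 2 with ε
    · simp [slope_def_field]
      ring
    · simp
      ring


/-- The reversed Kullback–Leibler divergence has the same local quadratic behavior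
as the forward one: for a positive probability distribution `P` on a nonempty finite
set and a perturbation `J` summing to zero,
`D(P + εJ ‖ P) / ε² → (1/2) ∑ J(x)²/P(x)` as `ε → 0` within the punctured
neighborhood of `0`. -/
theorem kl_divergence_reversed_local_quadratic_approx
    {X : Type*} [Fintype X] [Nonempty X]
    (P J : X → ℝ) (hP0 : ∀ x, 0 < P x) (hP1 : ∑ x, P x = 1)
    (hJ : ∑ x, J x = 0) :
    Filter.Tendsto
      (fun ε : ℝ => (∑ x, (P x + ε * J x) * Real.log ((P x + ε * J x) / P x)) / ε ^ 2)
      (nhdsWithin 0 {(0 : ℝ)}ᶜ)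
      (nhds ((1 / 2) * ∑ x, (J x) ^ 2 / P x)) := by
  have hterm (x : X) := (tendsto_mul_log_one_add_sub_div_sq (J x / P x)).const_mul (P x)
  have hsum := tendsto_finsetSum Finset.univ fun x _ => hterm x
  convert! hsum using 2 with ε
  · have hx (x : X) : (P x + ε * J x) * Real.log ((P x + ε * J x) / P x) =
        P x * ((1 + ε * (J x / P x)) * Real.log (1 + ε * (J x / P x)) - ε * (J x / P x))
          + ε * J x := by
      have := (hP0 x).ne'
      rw [show (P x + ε * J x) / P x = 1 + ε * (J x / P x) by field_simp]
      field_simp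
      ring
    simp_rw [hx, Finset.sum_add_distrib, ← Finset.mul_sum, hJ, ← mul_div_assoc]
    rw [mul_zero, add_zero, Finset.sum_div]
  · rw [Finset.mul_sum]
    refine Finset.sum_congr rfl fun x _ => ?_
    have := (hP0 x).ne'
    field_simp
end

section
/- Single-letterization for the point-to-point channel: Let X, Y be nonempty finite sets and B a real matrix indexed by Y × X such that B is a contraction (∑_y ((Bψ)(y))² ≤ ∑_x ψ(x)² for every ψ : X → ℝ) and Bᵀ·(B·v₀) = v₀ for a fixed unit vector v₀ : X → ℝ (∑_x v₀(x)² = 1). Then for every n ≥ 1 and every ψ : (Fin n → X) → ℝ with ⟨ψ, v₀^(n)⟩ = 0, there exists φ : X → ℝ with ‖φ‖ = ‖ψ‖, ⟨φ, v₀⟩ = 0, and ‖B^(n)·ψ‖ ≤ ‖B·φ‖. In particular, the n-letter linear information coupling problem max ‖B^(n)ψ‖ over unit ψ orthogonal to v₀^(n) has the same value as the single-letter problem; its optimum is the second largest singular value of B. -/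
open Matrix in
/-- A bound on the action of `A` on the columns of `M` gives a bound on the Frobenius norms. -/
lemma sum_sq_mul_le {X Y Z : Type*} [Fintype X] [Fintype Y] [Fintype Z]
    (A : Matrix Y X ℝ) (M : Matrix X Z ℝ) (s : ℝ)
    (h : ∀ z, ∑ y, (A *ᵥ M.col z) y ^ 2 ≤ s * ∑ x, M x z ^ 2) :
    ∑ y, ∑ z, (A * M) y z ^ 2 ≤ s * ∑ x, ∑ z, M x z ^ 2 := by
  rw [Finset.sum_comm, Finset.sum_comm (f := fun x z => M x z ^ 2), Finset.mul_sum]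
  exact Finset.sum_le_sum fun z _ => h z

open Matrix in
lemma sum_sq_mul_transpose_le {X Y Z : Type*} [Fintype X] [Fintype Y] [Fintype Z]
    (C : Matrix Y X ℝ) (hC : ∀ ψ : X → ℝ, ∑ y, (C *ᵥ ψ) y ^ 2 ≤ ∑ x, ψ x ^ 2)
    (M : Matrix Z X ℝ) :
    ∑ z, ∑ y, (M * Cᵀ) z y ^ 2 ≤ ∑ z, ∑ x, M z x ^ 2 := by
  have h := sum_sq_mul_le C Mᵀ 1 fun z => by simpa using hC (Mᵀ.col z)
  rw [one_mul, Finset.sum_comm, Finset.sum_comm (f := fun x z => Mᵀ x z ^ 2)] at h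
  have e : M * Cᵀ = (C * Mᵀ)ᵀ := by simp
  rw [e]
  exact h

open Matrix in
/-- Pythagoras for the Frobenius norm. -/
lemma sum_sq_vecMulVec_add {Y Z : Type*} [Fintype Y] [Fintype Z]
    (p : Y → ℝ) (q : Z → ℝ) (R : Matrix Y Z ℝ) (h : p ᵥ* R = 0) :
    ∑ y, ∑ z, (vecMulVec p q + R) y z ^ 2 =
      (∑ y, p y ^ 2) * (∑ z, q z ^ 2) + ∑ y, ∑ z, R y z ^ 2 := by
  have cross : ∑ y, ∑ z, p y * q z * R y z = 0 := by
    rw [Finset.sum_comm]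
    refine Finset.sum_eq_zero fun z _ => ?_
    have hz : ∑ y, p y * R y z = 0 := congrFun h z
    calc ∑ y, p y * q z * R y z = q z * ∑ y, p y * R y z := by
          rw [Finset.mul_sum]
          exact Finset.sum_congr rfl fun y _ => by ring
      _ = 0 := by rw [hz, mul_zero]
  have expand : ∀ y z, (vecMulVec p q + R) y z ^ 2 =
      p y ^ 2 * q z ^ 2 + 2 * (p y * q z * R y z) + R y z ^ 2 := fun y z => by
    rw [Matrix.add_apply, vecMulVec_apply]
    ring
  simp only [expand, Finset.sum_add_distrib, ← Finset.mul_sum, cross]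
  rw [Finset.sum_mul]
  ring

open Matrix in
/-- The singular value gap of a Kronecker product, acting on `M` as `M ↦ A * M * Cᵀ`. -/
lemma sum_sq_mul_mul_transpose_le_of_orthogonal
    {X Y X' Y' : Type*} [Fintype X] [Fintype Y] [Fintype X'] [Fintype Y']
    (A : Matrix Y X ℝ) (v : X → ℝ) (hv : ∑ x, v x ^ 2 = 1) (hfix : Aᵀ *ᵥ (A *ᵥ v) = v)
    (C : Matrix Y' X' ℝ) (hC : ∀ ψ : X' → ℝ, ∑ y, (C *ᵥ ψ) y ^ 2 ≤ ∑ x, ψ x ^ 2)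
    (w : X' → ℝ) (s : ℝ)
    (hA_gap : ∀ φ : X → ℝ, φ ⬝ᵥ v = 0 → ∑ y, (A *ᵥ φ) y ^ 2 ≤ s * ∑ x, φ x ^ 2)
    (hC_gap : ∀ φ : X' → ℝ, φ ⬝ᵥ w = 0 → ∑ y, (C *ᵥ φ) y ^ 2 ≤ s * ∑ x, φ x ^ 2)
    (M : Matrix X X' ℝ) (hM : (v ᵥ* M) ⬝ᵥ w = 0) :
    ∑ y, ∑ y', (A * M * Cᵀ) y y' ^ 2 ≤ s * ∑ x, ∑ x', M x x' ^ 2 := by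
  have hvv : v ⬝ᵥ v = 1 := by simpa [dotProduct, sq] using hv
  set a := v ᵥ* M with ha
  set R := M - vecMulVec v a with hR
  have hMR : M = vecMulVec v a + R := by rw [hR]; abel
  have hvR : v ᵥ* R = 0 := by
    rw [hR, vecMul_sub, vecMul_vecMulVec, hvv, one_smul, ← ha, sub_self]
  have hAv : (A *ᵥ v) ᵥ* A = v := by rw [← mulVec_transpose, hfix]
  have hAvAv : ∑ y, (A *ᵥ v) y ^ 2 = 1 := by
    have : (A *ᵥ v) ⬝ᵥ (A *ᵥ v) = 1 := by rw [dotProduct_mulVec, hAv, hvv]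
    simpa [dotProduct, sq] using this
  have hprod : A * M * Cᵀ = vecMulVec (A *ᵥ v) (C *ᵥ a) + A * R * Cᵀ := by
    conv_lhs => rw [hMR]
    rw [Matrix.mul_add, Matrix.add_mul, mul_vecMulVec, vecMulVec_mul, vecMul_transpose]
  have horth : (A *ᵥ v) ᵥ* (A * R * Cᵀ) = 0 := by
    rw [← vecMul_vecMul, ← vecMul_vecMul, hAv, hvR, zero_vecMul]
  have hAR : ∑ y, ∑ x', (A * R) y x' ^ 2 ≤ s * ∑ x, ∑ x', R x x' ^ 2 :=
    sum_sq_mul_le A R s fun z => hA_gap _ <| by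
      rw [dotProduct_comm]
      exact congrFun hvR z
  have hnorm : ∑ x, ∑ x', M x x' ^ 2 = (∑ x', a x' ^ 2) + ∑ x, ∑ x', R x x' ^ 2 := by
    conv_lhs => rw [hMR]
    rw [sum_sq_vecMulVec_add v a R hvR, hv, one_mul]
  rw [hprod, sum_sq_vecMulVec_add _ _ _ horth, hAvAv, one_mul, hnorm, mul_add]
  exact add_le_add (hC_gap a hM) ((sum_sq_mul_transpose_le C hC _).trans hAR)

/-- The `n`-th Kronecker power of a matrix. -/
def kroneckerPow {X Y : Type*} (B : Matrix Y X ℝ) (n : ℕ) :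
    Matrix (Fin n → Y) (Fin n → X) ℝ :=
  Matrix.of fun r c => ∏ j, B (r j) (c j)

lemma sum_fin_succ_pi {X : Type*} [Fintype X] (n : ℕ) (f : (Fin (n + 1) → X) → ℝ) :
    ∑ c, f c = ∑ x, ∑ c : Fin n → X, f (Fin.cons x c) := by
  rw [← Fintype.sum_prod_type']
  exact (Fintype.sum_equiv (Fin.consEquiv fun _ => X) _ _ fun _ => rfl).symm

open Matrix in
lemma kroneckerPow_succ_mulVec {X Y : Type*} [Fintype X] (B : Matrix Y X ℝ)
    (n : ℕ) (ψ : (Fin (n + 1) → X) → ℝ) (y : Y) (r : Fin n → Y) :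
    (kroneckerPow B (n + 1) *ᵥ ψ) (Fin.cons y r) =
      (B * (Matrix.of fun x c => ψ (Fin.cons x c)) * (kroneckerPow B n)ᵀ) y r := by
  rw [Matrix.mul_assoc, Matrix.mul_apply]
  simp only [mulVec, dotProduct, sum_fin_succ_pi, Matrix.mul_apply, kroneckerPow, of_apply,
    transpose_apply, Fin.prod_univ_succ, Fin.cons_zero, Fin.cons_succ, Finset.mul_sum]
  exact Finset.sum_congr rfl fun x _ => Finset.sum_congr rfl fun c _ => by ring

open Matrix in
lemma sum_sq_kroneckerPow_mulVec_le {X Y : Type*} [Fintype X] [Fintype Y] (B : Matrix Y X ℝ)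
    (hB : ∀ ψ : X → ℝ, ∑ y, (B *ᵥ ψ) y ^ 2 ≤ ∑ x, ψ x ^ 2) (n : ℕ)
    (ψ : (Fin n → X) → ℝ) :
    ∑ r, (kroneckerPow B n *ᵥ ψ) r ^ 2 ≤ ∑ c, ψ c ^ 2 := by
  induction n with
  | zero => simp [kroneckerPow, mulVec, dotProduct]
  | succ n ih =>
    simp only [sum_fin_succ_pi, kroneckerPow_succ_mulVec]
    refine (sum_sq_mul_transpose_le _ ih _).trans ?_
    have h := sum_sq_mul_le B (Matrix.of fun x (c : Fin n → X) => ψ (Fin.cons x c)) 1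
      fun z => (hB _).trans_eq (one_mul _).symm
    simpa using h

open Matrix in
/-- The singular value gap of a contraction carries over to its Kronecker powers. -/
lemma sum_sq_kroneckerPow_mulVec_le_of_orthogonal {X Y : Type*} [Fintype X] [Fintype Y]
    (B : Matrix Y X ℝ) (hB : ∀ ψ : X → ℝ, ∑ y, (B *ᵥ ψ) y ^ 2 ≤ ∑ x, ψ x ^ 2)
    (v : X → ℝ) (hv : ∑ x, v x ^ 2 = 1) (hfix : Bᵀ *ᵥ (B *ᵥ v) = v) (s : ℝ)
    (hgap : ∀ φ : X → ℝ, φ ⬝ᵥ v = 0 → ∑ y, (B *ᵥ φ) y ^ 2 ≤ s * ∑ x, φ x ^ 2)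
    (n : ℕ) (ψ : (Fin n → X) → ℝ) (horth : (ψ ⬝ᵥ fun c => ∏ j, v (c j)) = 0) :
    ∑ r, (kroneckerPow B n *ᵥ ψ) r ^ 2 ≤ s * ∑ c, ψ c ^ 2 := by
  induction n with
  | zero =>
    have : ψ default = 0 := by simpa [dotProduct] using horth
    simp [kroneckerPow, mulVec, dotProduct, this]
  | succ n ih =>
    simp only [sum_fin_succ_pi, kroneckerPow_succ_mulVec]
    refine sum_sq_mul_mul_transpose_le_of_orthogonal B v hv hfix (kroneckerPow B n)
      (sum_sq_kroneckerPow_mulVec_le B hB n) (fun c => ∏ j, v (c j)) s hgap ih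
      (Matrix.of fun x c => ψ (Fin.cons x c)) ?_
    rw [← dotProduct_mulVec, ← horth]
    simp only [dotProduct, mulVec, sum_fin_succ_pi, Fin.prod_univ_succ, Fin.cons_zero,
      Fin.cons_succ, of_apply, Finset.mul_sum]
    exact Finset.sum_congr rfl fun x _ => Finset.sum_congr rfl fun c _ => by ring

open Matrix in
/-- If the orthogonal complement of `v` is trivial, so is that of its tensor power. -/
lemma eq_zero_of_orthogonal_tensorPow {X : Type*} [Fintype X]
    (v : X → ℝ) (hv : ∑ x, v x ^ 2 = 1)
    (htriv : ∀ φ : X → ℝ, φ ⬝ᵥ v = 0 → φ = 0)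
    (n : ℕ) (ψ : (Fin n → X) → ℝ) (horth : (ψ ⬝ᵥ fun c => ∏ j, v (c j)) = 0) : ψ = 0 := by
  classical
  have h := sum_sq_kroneckerPow_mulVec_le_of_orthogonal (1 : Matrix X X ℝ) (by simp) v hv
    (by simp) 0 (fun φ hφ => by simp [htriv φ hφ]) n ψ horth
  have h1 : kroneckerPow (1 : Matrix X X ℝ) n = 1 := by
    ext r c
    simp [kroneckerPow, Matrix.one_apply, Finset.prod_ite_zero, funext_iff]
  rw [h1, one_mulVec, zero_mul] at h
  funext c
  have hc := (Finset.sum_eq_zero_iff_of_nonneg fun c _ => sq_nonneg (ψ c)).1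
    (le_antisymm h (Finset.sum_nonneg fun c _ => sq_nonneg _)) c (Finset.mem_univ c)
  simpa using hc

open Matrix in
/-- The largest gain of `B` on the orthogonal complement of `v` is attained. -/
lemma exists_unit_orthogonal_maximizer {X Y : Type*} [Fintype X] [Fintype Y]
    (B : Matrix Y X ℝ) (v : X → ℝ) (hne : ∃ φ : X → ℝ, φ ⬝ᵥ v = 0 ∧ φ ≠ 0) :
    ∃ u : X → ℝ, ∑ x, u x ^ 2 = 1 ∧ u ⬝ᵥ v = 0 ∧
      ∀ φ : X → ℝ, φ ⬝ᵥ v = 0 →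
        ∑ y, (B *ᵥ φ) y ^ 2 ≤ (∑ y, (B *ᵥ u) y ^ 2) * ∑ x, φ x ^ 2 := by
  have normalize : ∀ φ : X → ℝ, φ ≠ 0 → 0 < ∑ x, φ x ^ 2 ∧
      ∑ x, (((√(∑ x, φ x ^ 2))⁻¹ • φ) x) ^ 2 = 1 := by
    intro φ hφ
    obtain ⟨x, hx⟩ := Function.ne_iff.1 hφ
    have hpos : 0 < ∑ x, φ x ^ 2 :=
      Finset.sum_pos' (fun _ _ => sq_nonneg _) ⟨x, Finset.mem_univ x, by simpa [sq_pos_iff] using hx⟩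
    refine ⟨hpos, ?_⟩
    simp only [Pi.smul_apply, smul_eq_mul, mul_pow, inv_pow, Real.sq_sqrt hpos.le,
      ← Finset.mul_sum]
    exact inv_mul_cancel₀ hpos.ne'
  set S : Set (X → ℝ) := {φ | ∑ x, φ x ^ 2 = 1 ∧ φ ⬝ᵥ v = 0} with hS
  have hclosed : IsClosed S := by
    refine (isClosed_eq (by fun_prop) continuous_const).inter
      (isClosed_eq ?_ continuous_const)
    simp only [dotProduct]
    fun_prop
  have hsub : S ⊆ Set.Icc (fun _ => -1) (fun _ => 1) := by
    rintro φ ⟨h1, -⟩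
    have hx : ∀ x, φ x ^ 2 ≤ 1 := fun x => h1 ▸
      Finset.single_le_sum (f := fun x => φ x ^ 2) (fun _ _ => sq_nonneg _) (Finset.mem_univ x)
    exact ⟨fun x => (abs_le.1 ((sq_le_one_iff_abs_le_one _).1 (hx x))).1,
      fun x => (abs_le.1 ((sq_le_one_iff_abs_le_one _).1 (hx x))).2⟩
  have hcompact : IsCompact S := isCompact_Icc.of_isClosed_subset hclosed hsub
  have hnonempty : S.Nonempty := by
    obtain ⟨φ, hφ, hφ0⟩ := hne
    exact ⟨_, (normalize φ hφ0).2, by rw [smul_dotProduct, hφ, smul_zero]⟩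
  have hcont : Continuous fun φ : X → ℝ => ∑ y, (B *ᵥ φ) y ^ 2 := by
    simp only [mulVec, dotProduct]
    fun_prop
  obtain ⟨u, ⟨hu1, huv⟩, hmax⟩ := hcompact.exists_isMaxOn hnonempty hcont.continuousOn
  refine ⟨u, hu1, huv, fun φ hφ => ?_⟩
  rcases eq_or_ne φ 0 with rfl | hφ0
  · simp
  obtain ⟨hpos, hunit⟩ := normalize φ hφ0
  have h : ∑ y, (B *ᵥ ((√(∑ x, φ x ^ 2))⁻¹ • φ)) y ^ 2 ≤ ∑ y, (B *ᵥ u) y ^ 2 :=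
    hmax ⟨hunit, by rw [smul_dotProduct, hφ, smul_zero]⟩
  simp only [mulVec_smul, Pi.smul_apply, smul_eq_mul, mul_pow, inv_pow, Real.sq_sqrt hpos.le,
    ← Finset.mul_sum] at h
  rwa [inv_mul_le_iff₀ hpos, mul_comm] at h

/-- Single-letterization for the point-to-point channel: if `B` is a contraction
fixing the unit vector `v₀` (in the sense `Bᵀ(Bv₀) = v₀`), then for every `n ≥ 1`
and every `ψ` on `n` letters orthogonal to the tensor power `v₀^(n)`, there is a
single-letter vector `φ` with the same norm, orthogonal to `v₀`, whose image
under `B` is at least as large as the image of `ψ` under the Kronecker power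
`B^(n)`. -/
theorem single_letterization_point_to_point
    {X Y : Type*} [Fintype X] [Fintype Y] [Nonempty X] [Nonempty Y]
    (B : Matrix Y X ℝ)
    (hcontr : ∀ ψ : X → ℝ, ∑ y, (B.mulVec ψ y) ^ 2 ≤ ∑ x, ψ x ^ 2)
    (v₀ : X → ℝ) (hv₀ : ∑ x, v₀ x ^ 2 = 1)
    (hfix : B.transpose.mulVec (B.mulVec v₀) = v₀)
    (n : ℕ) (hn : 1 ≤ n)
    (ψ : (Fin n → X) → ℝ)
    (horth : ∑ c : Fin n → X, ψ c * ∏ j, v₀ (c j) = 0) :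
    ∃ φ : X → ℝ,
      (∑ x, φ x ^ 2 = ∑ c : Fin n → X, ψ c ^ 2) ∧
      (∑ x, φ x * v₀ x = 0) ∧
      ∑ r : Fin n → Y,
          ((Matrix.of fun (r : Fin n → Y) (c : Fin n → X) =>
              ∏ j, B (r j) (c j)).mulVec ψ r) ^ 2
        ≤ ∑ y, (B.mulVec φ y) ^ 2 := by
  change (ψ ⬝ᵥ fun c => ∏ j, v₀ (c j)) = 0 at horth
  by_cases hne : ∃ φ : X → ℝ, φ ⬝ᵥ v₀ = 0 ∧ φ ≠ 0
  · obtain ⟨u, hu1, huv, hmax⟩ := exists_unit_orthogonal_maximizer B v₀ hne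
    have hnorm : √(∑ c, ψ c ^ 2) ^ 2 = ∑ c, ψ c ^ 2 :=
      Real.sq_sqrt (Finset.sum_nonneg fun c _ => sq_nonneg _)
    refine ⟨√(∑ c, ψ c ^ 2) • u, ?_, ?_, ?_⟩
    · simp only [Pi.smul_apply, smul_eq_mul, mul_pow, hnorm, ← Finset.mul_sum, hu1, mul_one]
    · change (√(∑ c, ψ c ^ 2) • u) ⬝ᵥ v₀ = 0
      rw [smul_dotProduct, huv, smul_zero]
    · simp only [Matrix.mulVec_smul, Pi.smul_apply, smul_eq_mul, mul_pow, hnorm,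
        ← Finset.mul_sum]
      rw [mul_comm]
      exact sum_sq_kroneckerPow_mulVec_le_of_orthogonal B hcontr v₀ hv₀ hfix _ hmax n ψ horth
  · push Not at hne
    have hψ := eq_zero_of_orthogonal_tensorPow v₀ hv₀ hne n ψ horth
    exact ⟨0, by simp [hψ], by simp, by simp [hψ]⟩
end

section
/- Proposition 1 (second singular value of the DTM equals the Rényi–Hirschfeld–Gebelein maximal correlation): Let X and Y be finite sets each with at least two elements, and let p : X × Y → ℝ be a joint probability distribution (p ≥ 0, ∑_{x,y} p(x,y) = 1) whose marginals P_X(x) = ∑_y p(x,y) and P_Y(y) = ∑_x p(x,y) are strictly positive. Define the maximal correlation ρ_m = sSup { ∑_{x,y} p(x,y)·f(x)·g(y) : f : X → ℝ, g : Y → ℝ, ∑_x P_X(x)·f(x) = 0, ∑_y P_Y(y)·g(y) = 0, ∑_x P_X(x)·f(x)² = 1, ∑_y P_Y(y)·g(y)² = 1 }, and define the DTM B(y,x) = p(x,y)/(√(P_X(x))·√(P_Y(y))). Then ρ_m = sSup { √(∑_y (∑_x B(y,x)·ψ(x))²) : ψ : X → ℝ, ∑_x ψ(x)² = 1, ∑_x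 √(P_X(x))·ψ(x) = 0 }, i.e. the maximal correlation equals the second largest singular value of B. -/
/-- A centred function with positive second moment, rescaled to have unit second moment. -/
lemma moments_standardization {Y : Type*} [Fintype Y] (w h : Y → ℝ)
    (h0 : ∑ y, w y * h y = 0) (hpos : 0 < ∑ y, w y * h y ^ 2) :
    ∑ y, w y * (h y / √(∑ z, w z * h z ^ 2)) = 0 ∧
      ∑ y, w y * (h y / √(∑ z, w z * h z ^ 2)) ^ 2 = 1 := by
  constructor
  · simp only [← mul_div_assoc, ← Finset.sum_div, h0, zero_div]
  · simp only [div_pow, Real.sq_sqrt hpos.le, ← mul_div_assoc, ← Finset.sum_div]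
    exact div_self hpos.ne'

/-- With at least two points of positive weight, there is a centred function of unit second
moment. -/
lemma exists_centred_unit {Y : Type*} [Fintype Y] (hY : 2 ≤ Fintype.card Y) (w : Y → ℝ)
    (hw : ∀ y, 0 < w y) :
    ∃ g : Y → ℝ, ∑ y, w y * g y = 0 ∧ ∑ y, w y * g y ^ 2 = 1 := by
  classical
  obtain ⟨a, b, hab⟩ := Fintype.one_lt_card_iff.mp (by omega : 1 < Fintype.card Y)
  let u : Y → ℝ := Pi.single a (w b) - Pi.single b (w a)
  have h0 : ∑ y, w y * u y = 0 := by
    simp [u, mul_sub, Finset.sum_sub_distrib, Pi.single_apply, mul_comm]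
  have hpos : 0 < ∑ y, w y * u y ^ 2 := by
    refine Finset.sum_pos' (fun y _ => mul_nonneg (hw y).le (sq_nonneg _))
      ⟨a, Finset.mem_univ a, mul_pos (hw a) ?_⟩
    have : u a = w b := by simp [u, hab]
    rw [this]
    exact pow_pos (hw b) 2
  exact ⟨_, moments_standardization w u h0 hpos⟩

/-- Cauchy–Schwarz for a weighted finite sum, against a function of unit second moment. -/
lemma sum_weight_mul_le_sqrt {Y : Type*} [Fintype Y] (w h g : Y → ℝ) (hw : ∀ y, 0 ≤ w y)
    (hg : ∑ y, w y * g y ^ 2 = 1) :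
    ∑ y, w y * h y * g y ≤ √(∑ y, w y * h y ^ 2) := by
  have key := Finset.sum_mul_sq_le_sq_mul_sq Finset.univ
    (fun y => √(w y) * h y) (fun y => √(w y) * g y)
  simp only [mul_pow, Real.sq_sqrt (hw _), hg, mul_one] at key
  have heq : ∑ y, √(w y) * h y * (√(w y) * g y) = ∑ y, w y * h y * g y := by
    refine Finset.sum_congr rfl fun y _ => ?_
    linear_combination (h y * g y) * Real.mul_self_sqrt (hw y)
  rw [heq] at key
  exact Real.le_sqrt_of_sq_le key


/-- Proposition 1: the Rényi–Hirschfeld–Gebelein maximal correlation of a joint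
distribution `p` on `X × Y` with strictly positive marginals equals the second
largest singular value of the divergence transition matrix
`B(y,x) = p(x,y)/(√(P_X(x))·√(P_Y(y)))`, i.e. the supremum of `‖Bψ‖` over unit
vectors `ψ` orthogonal to `√P_X`. -/
theorem maximal_correlation_eq_second_singular_value
    {X Y : Type*} [Fintype X] [Fintype Y]
    (hX : 2 ≤ Fintype.card X) (hY : 2 ≤ Fintype.card Y)
    (p : X → Y → ℝ) (hp0 : ∀ x y, 0 ≤ p x y) (hp1 : ∑ x, ∑ y, p x y = 1)
    (PX : X → ℝ) (hPX : ∀ x, PX x = ∑ y, p x y) (hPX0 : ∀ x, 0 < PX x)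
    (PY : Y → ℝ) (hPY : ∀ y, PY y = ∑ x, p x y) (hPY0 : ∀ y, 0 < PY y)
    (B : Y → X → ℝ)
    (hB : ∀ y x, B y x = p x y / (Real.sqrt (PX x) * Real.sqrt (PY y))) :
    sSup { ρ : ℝ | ∃ f : X → ℝ, ∃ g : Y → ℝ,
        (∑ x, PX x * f x = 0) ∧ (∑ y, PY y * g y = 0) ∧
        (∑ x, PX x * f x ^ 2 = 1) ∧ (∑ y, PY y * g y ^ 2 = 1) ∧
        ρ = ∑ x, ∑ y, p x y * f x * g y } =
    sSup { s : ℝ | ∃ ψ : X → ℝ,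
        (∑ x, ψ x ^ 2 = 1) ∧ (∑ x, Real.sqrt (PX x) * ψ x = 0) ∧
        s = Real.sqrt (∑ y, (∑ x, B y x * ψ x) ^ 2) } := by
  let h : (X → ℝ) → Y → ℝ := fun f y => (∑ x, p x y * f x) / PY y
  have hw (f : X → ℝ) (y : Y) : PY y * h f y = ∑ x, p x y * f x :=
    mul_div_cancel₀ _ (hPY0 y).ne'
  have hmean (f : X → ℝ) : ∑ y, PY y * h f y = ∑ x, PX x * f x := by
    simp only [hw, hPX, Finset.sum_mul]
    exact Finset.sum_comm
  have hcorr (f : X → ℝ) (g : Y → ℝ) :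
      ∑ x, ∑ y, p x y * f x * g y = ∑ y, PY y * h f y * g y := by
    simp only [hw, Finset.sum_mul]
    exact Finset.sum_comm
  have hnorm (f : X → ℝ) :
      ∑ y, (∑ x, B y x * (√(PX x) * f x)) ^ 2 = ∑ y, PY y * h f y ^ 2 := by
    refine Finset.sum_congr rfl fun y _ => ?_
    have hy := Real.sqrt_pos.mpr (hPY0 y)
    have : ∑ x, B y x * (√(PX x) * f x) = (∑ x, p x y * f x) / √(PY y) := by
      rw [Finset.sum_div]
      refine Finset.sum_congr rfl fun x _ => ?_
      have hx := Real.sqrt_pos.mpr (hPX0 x)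
      rw [hB]
      field_simp
    rw [this, ← hw, div_pow, Real.sq_sqrt (hPY0 y).le]
    have := (hPY0 y).ne'
    field_simp
  apply csSup_eq_csSup_of_forall_exists_le
  · rintro _ ⟨f, g, hf0, -, hf1, hg1, rfl⟩
    refine ⟨_, ⟨fun x => √(PX x) * f x, ?_, ?_, rfl⟩, ?_⟩
    · simpa only [mul_pow, Real.sq_sqrt (hPX0 _).le] using hf1
    · simpa only [← mul_assoc, Real.mul_self_sqrt (hPX0 _).le] using hf0
    · rw [hnorm, hcorr]
      exact sum_weight_mul_le_sqrt PY (h f) g (fun y => (hPY0 y).le) hg1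
  · rintro _ ⟨ψ, hψ1, hψ0, rfl⟩
    obtain ⟨f, rfl⟩ : ∃ f : X → ℝ, ψ = fun x => √(PX x) * f x :=
      ⟨fun x => ψ x / √(PX x), funext fun x =>
        (mul_div_cancel₀ _ (Real.sqrt_pos.mpr (hPX0 x)).ne').symm⟩
    have hf1 : ∑ x, PX x * f x ^ 2 = 1 := by
      simpa only [mul_pow, Real.sq_sqrt (hPX0 _).le] using hψ1
    have hf0 : ∑ x, PX x * f x = 0 := by
      simpa only [← mul_assoc, Real.mul_self_sqrt (hPX0 _).le] using hψ0
    have hnonneg : ∀ y ∈ Finset.univ, 0 ≤ PY y * h f y ^ 2 :=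
      fun y _ => mul_nonneg (hPY0 y).le (sq_nonneg _)
    rw [hnorm]
    rcases (Finset.sum_nonneg hnonneg).eq_or_lt with hzero | hpos
    · obtain ⟨g, hg0, hg1⟩ := exists_centred_unit hY PY hPY0
      refine ⟨_, ⟨f, g, hf0, hg0, hf1, hg1, rfl⟩, ?_⟩
      rw [hcorr, ← hzero, Real.sqrt_zero]
      have hh : ∀ y, h f y = 0 := fun y => by
        have := (Finset.sum_eq_zero_iff_of_nonneg hnonneg).mp hzero.symm y (Finset.mem_univ y)
        simpa [(hPY0 y).ne'] using this
      simp [hh]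
    · obtain ⟨hg0, hg1⟩ := moments_standardization PY (h f) ((hmean f).trans hf0) hpos
      refine ⟨_, ⟨f, _, hf0, hg0, hf1, hg1, rfl⟩, ?_⟩
      rw [hcorr]
      simp only [← mul_div_assoc, ← Finset.sum_div, mul_assoc, ← pow_two]
      rw [Real.div_sqrt]
end

section
/- Lemma 6 (sparse optimal solutions of diagonal quadratic programs): Let M ≥ 1 and k ≥ 1, let θ₁,…,θ_k : Fin M → ℝ be the diagonal entries of diagonal matrices Θ₁,…,Θ_k, and let λ₁,…,λ_{k−1} ∈ ℝ. Let S = { c : Fin M → ℝ : ∑_j c(j)² = 1 and ∑_j θ_i(j)²·c(j)² = λ_i for every i = 1,…,k−1 }. If there exists c* ∈ S such that ∑_j θ_k(j)²·c(j)² ≤ ∑_j θ_k(j)²·c*(j)² for all c ∈ S (a global maximizer of ‖Θ_k c‖² over S), then there exists a global maximizer c' ∈ S with at most k nonzero entries, i.e. the cardinality of { j : c'(j) ≠ 0 } is at most k. -/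
/-- Moving from `x ≥ 0` along a direction `d` supported in the support of `x` and having a negative
entry, one can stay nonnegative until an entry in the support of `x` vanishes. -/
lemma exists_nonneg_add_smul_support_ssubset {ι : Type*} [Fintype ι] {x d : ι → ℝ}
    (hx : 0 ≤ x) (hd : ∀ j, x j = 0 → d j = 0) (hneg : ∃ j, d j < 0) :
    ∃ t : ℝ, 0 ≤ t ∧ 0 ≤ x + t • d ∧
      Function.support (x + t • d) ⊂ Function.support x := by
  classical
  obtain ⟨j₀, hj₀⟩ := hneg
  obtain ⟨m, hm, hmin⟩ := Finset.exists_min_image (Finset.univ.filter fun j => d j < 0)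
    (fun j => x j / -d j) ⟨j₀, by simpa using hj₀⟩
  simp only [Finset.mem_filter, Finset.mem_univ, true_and] at hm hmin
  have ht : 0 ≤ x m / -d m := div_nonneg (hx m) (by linarith)
  refine ⟨x m / -d m, ht, fun j => ?_, ?_⟩
  · simp only [Pi.zero_apply, Pi.add_apply, Pi.smul_apply, smul_eq_mul]
    rcases lt_or_ge (d j) 0 with hj | hj
    · have := (le_div_iff₀ (by linarith : 0 < -d j)).1 (hmin j hj)
      linarith
    · exact add_nonneg (hx j) (mul_nonneg ht hj)
  · have hsub : Function.support (x + (x m / -d m) • d) ⊆ Function.support x :=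
      fun j hj hxj => hj (by simp [hxj, hd j hxj])
    refine (Set.ssubset_iff_of_subset hsub).2 ⟨m, fun hxm => hm.ne (hd m hxm), fun h => h ?_⟩
    simp [div_neg, div_mul_cancel₀ _ hm.ne]

/-- A feasible point of a linear program in standard form, with columns `v j` in an open half-space,
can be replaced by one with at least the same objective value and at most `finrank ℝ E` nonzero
entries. -/
lemma exists_nonneg_ncard_support_le_finrank {ι E : Type*} [Fintype ι] [AddCommGroup E]
    [Module ℝ E] [FiniteDimensional ℝ E] (v : ι → E) (φ : E →ₗ[ℝ] ℝ) (hφ : ∀ j, 0 < φ (v j))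
    (f : ι → ℝ) (x : ι → ℝ) (hx : 0 ≤ x) :
    ∃ y : ι → ℝ, 0 ≤ y ∧ ∑ j, y j • v j = ∑ j, x j • v j ∧
      ∑ j, f j * x j ≤ ∑ j, f j * y j ∧
      (Function.support y).ncard ≤ Module.finrank ℝ E := by
  classical
  induction hn : (Function.support x).ncard using Nat.strong_induction_on generalizing x with
  | _ n ih =>
  by_cases hcard : (Function.support x).ncard ≤ Module.finrank ℝ E
  · exact ⟨x, hx, rfl, le_rfl, hcard⟩
  obtain ⟨d, hd, hdv, hdf, hdne⟩ : ∃ d : ι → ℝ, (∀ j, x j = 0 → d j = 0) ∧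
      ∑ j, d j • v j = 0 ∧ 0 ≤ ∑ j, f j * d j ∧ d ≠ 0 := by
    have hdep : ¬ LinearIndependent ℝ fun j : Function.support x => v j := fun h =>
      hcard (by simpa [Set.ncard_eq_toFinset_card'] using h.fintype_card_le_finrank)
    obtain ⟨g, hg, i, hi⟩ := Fintype.not_linearIndependent_iff.1 hdep
    let d : ι → ℝ := fun j => if h : j ∈ Function.support x then g ⟨j, h⟩ else 0
    have hd : ∀ j, x j = 0 → d j = 0 := fun j hj => by simp [d, hj]
    have hdg : ∀ j : Function.support x, d j = g j := fun j => dif_pos j.2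
    have hdv : ∑ j, d j • v j = 0 := by
      rw [← hg, ← Finset.sum_subset (Finset.subset_univ (Function.support x).toFinset)
        fun j _ hj => by simp [hd j (by simpa using hj)],
        ← Finset.sum_coe_sort,
        ← Equiv.sum_comp (Equiv.subtypeEquivRight fun j => Set.mem_toFinset.symm)]
      simp [hdg]
    have hdne : d ≠ 0 := fun h => hi (by rw [← hdg, h, Pi.zero_apply])
    rcases le_total 0 (∑ j, f j * d j) with h | h
    · exact ⟨d, hd, hdv, h, hdne⟩
    · exact ⟨-d, fun j hj => by simp [hd j hj], by simp [hdv], by simpa using h,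
        neg_ne_zero.2 hdne⟩
  have hneg : ∃ j, d j < 0 := by
    by_contra! hpos
    have hsum : ∑ j, d j * φ (v j) = 0 := by simpa using congrArg φ hdv
    rw [Finset.sum_eq_zero_iff_of_nonneg fun j _ => mul_nonneg (hpos j) (hφ j).le] at hsum
    exact hdne (funext fun j =>
      (mul_eq_zero.1 (hsum j (Finset.mem_univ j))).resolve_right (hφ j).ne')
  obtain ⟨t, ht, hnonneg, hsupp⟩ := exists_nonneg_add_smul_support_ssubset hx hd hneg
  obtain ⟨y, hy, hyv, hyf, hyc⟩ :=
    ih _ (hn ▸ Set.ncard_lt_ncard hsupp (Set.toFinite _)) (x + t • d) hnonneg rfl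
  refine ⟨y, hy, ?_, le_trans ?_ hyf, hyc⟩
  · simp [hyv, add_smul, Finset.sum_add_distrib, mul_smul, ← Finset.smul_sum, hdv]
  · simp only [Pi.add_apply, Pi.smul_apply, smul_eq_mul, mul_add, Finset.sum_add_distrib,
      mul_left_comm _ t, ← Finset.mul_sum]
    exact le_add_of_nonneg_right (mul_nonneg ht hdf)

/-- Lemma 6 (sparse optimal solutions of diagonal quadratic programs): if the
problem of maximizing `‖Θ_k c‖² = ∑_j θ_k(j)²·c(j)²` over the set `S` of unit
vectors `c` satisfying the `k-1` diagonal quadratic constraints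
`∑_j θ_i(j)²·c(j)² = λ_i` has a global maximizer, then it has a global maximizer
with at most `k` nonzero entries. -/
theorem sparse_optimal_diagonal_quadratic
    (M k : ℕ) (hM : 1 ≤ M) (hk : 1 ≤ k)
    (θ : Fin k → Fin M → ℝ) (lam : Fin k → ℝ)
    (S : Set (Fin M → ℝ))
    (hS : S = { c | (∑ j, c j ^ 2 = 1) ∧
        ∀ i : Fin k, (i : ℕ) < k - 1 → ∑ j, (θ i j) ^ 2 * c j ^ 2 = lam i })
    (cstar : Fin M → ℝ) (hmem : cstar ∈ S)
    (hmax : ∀ c ∈ S, ∑ j, (θ ⟨k - 1, by omega⟩ j) ^ 2 * c j ^ 2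
        ≤ ∑ j, (θ ⟨k - 1, by omega⟩ j) ^ 2 * cstar j ^ 2) :
    ∃ c' ∈ S,
      (∀ c ∈ S, ∑ j, (θ ⟨k - 1, by omega⟩ j) ^ 2 * c j ^ 2
        ≤ ∑ j, (θ ⟨k - 1, by omega⟩ j) ^ 2 * c' j ^ 2) ∧
      ({ j | c' j ≠ 0 } : Set (Fin M)).ncard ≤ k := by
  subst hS
  let v : Fin M → Fin k → ℝ := fun j i => if (i : ℕ) < k - 1 then θ i j ^ 2 else 1
  obtain ⟨y, hy, hyv, hyf, hyc⟩ := exists_nonneg_ncard_support_le_finrank v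
    (LinearMap.proj ⟨k - 1, by omega⟩) (fun j => by simp [v])
    (fun j => θ ⟨k - 1, by omega⟩ j ^ 2) (fun j => cstar j ^ 2) (fun j => sq_nonneg _)
  have hsq : ∀ j, √(y j) ^ 2 = y j := fun j => Real.sq_sqrt (hy j)
  have hrow : ∀ i, ∑ j, y j * v j i = ∑ j, cstar j ^ 2 * v j i := fun i => by
    simpa [Finset.sum_apply] using congrFun hyv i
  refine ⟨fun j => √(y j), ⟨?_, fun i hi => ?_⟩, fun c hc => (hmax c hc).trans ?_, ?_⟩
  · simpa [hsq, v, hmem.1] using hrow ⟨k - 1, by omega⟩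
  · rw [← hmem.2 i hi]
    simpa [hsq, v, hi, mul_comm] using hrow i
  · simpa only [hsq] using hyf
  · have hsupp : {j | √(y j) ≠ 0} = Function.support y := by
      ext j
      simp [Real.sqrt_eq_zero (hy j)]
    simpa [hsupp] using hyc
end

section
/- Corollary 1 (sparse optimizers of min of diagonal quadratic forms): Let M ≥ 1 and k ≥ 1 and let θ₁,…,θ_k : Fin M → ℝ be the diagonal entries of diagonal matrices Θ₁,…,Θ_k. Then there exists c* : Fin M → ℝ with ∑_j c*(j)² = 1 and at most k nonzero entries such that for every c : Fin M → ℝ with ∑_j c(j)² = 1, min_{1≤i≤k} ∑_j θ_i(j)²·c(j)² ≤ min_{1≤i≤k} ∑_j θ_i(j)²·c*(j)²; i.e. the problem max_{‖c‖²=1} min_i ‖Θ_i c‖² has a global optimal solution supported on at most k coordinates. -/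
open Finset in
/-- A point of the standard simplex with more than `card κ` nonzero coordinates can be moved to one
with fewer nonzero coordinates without decreasing any of `card κ` nonnegative linear forms. -/
lemma exists_mem_stdSimplex_card_support_lt {ι κ : Type*} [Fintype ι] [DecidableEq ι] [Fintype κ]
    [Nonempty κ] (a : κ → ι → ℝ) (ha : ∀ i j, 0 ≤ a i j) {p : ι → ℝ} (hp : p ∈ stdSimplex ℝ ι)
    (hcard : Fintype.card κ < #{j | p j ≠ 0}) :
    ∃ q ∈ stdSimplex ℝ ι, #{j | q j ≠ 0} < #{j | p j ≠ 0} ∧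
      ∀ i, ∑ j, a i j * p j ≤ ∑ j, a i j * q j := by
  obtain ⟨hp0, hp1⟩ := hp
  obtain ⟨d, hd_ne, hd_sum, hd_supp, hd_ker⟩ : ∃ d : ι → ℝ, d ≠ 0 ∧ ∑ j, d j ≤ 0 ∧
      (∀ j, p j = 0 → d j = 0) ∧ ∀ i, ∑ j, a i j * d j = 0 := by
    let f : (ι → ℝ) →ₗ[ℝ] (κ → ℝ) × ({j // p j = 0} → ℝ) :=
      (Matrix.mulVecLin (Matrix.of a)).prod (LinearMap.funLeft ℝ ℝ Subtype.val)
    have hlt : Module.finrank ℝ ((κ → ℝ) × ({j // p j = 0} → ℝ)) < Module.finrank ℝ (ι → ℝ) := by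
      have h := card_filter_add_card_filter_not (s := (univ : Finset ι)) (fun j => p j = 0)
      rw [card_univ] at h
      simp only [ne_eq] at hcard
      simp only [Module.finrank_prod, Module.finrank_fintype_fun_eq_card, Fintype.card_subtype]
      omega
    obtain ⟨d, hd, hd_ne⟩ :=
      Submodule.exists_mem_ne_zero_of_ne_bot (LinearMap.ker_ne_bot_of_finrank_lt (f := f) hlt)
    have hd' : f d = 0 := hd
    have h1 : ∀ i, ∑ j, a i j * d j = 0 := fun i => congrFun (congrArg Prod.fst hd') i
    have h2 : ∀ j, p j = 0 → d j = 0 := fun j hj => congrFun (congrArg Prod.snd hd') ⟨j, hj⟩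
    rcases le_total (∑ j, d j) 0 with h | h
    · exact ⟨d, hd_ne, h, h2, h1⟩
    · refine ⟨-d, neg_ne_zero.2 hd_ne, by simpa using h, fun j hj => by simp [h2 j hj],
        fun i => by simp [h1 i]⟩
  have hneg : ({j | d j < 0} : Finset ι).Nonempty := by
    by_contra! h
    have h0 : ∀ j, 0 ≤ d j := by simpa [filter_eq_empty_iff] using h
    have := (sum_eq_zero_iff_of_nonneg fun j _ => h0 j).1
      (le_antisymm hd_sum (sum_nonneg fun j _ => h0 j))
    exact hd_ne (funext fun j => this j (mem_univ j))
  obtain ⟨j₀, hj₀, hmin⟩ := exists_min_image _ (fun j => p j / -d j) hneg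
  simp only [mem_filter, mem_univ, true_and] at hj₀ hmin
  set t := p j₀ / -d j₀ with ht
  have ht0 : 0 ≤ t := div_nonneg (hp0 j₀) (by linarith)
  have hq0 : ∀ j, 0 ≤ p j + t * d j := fun j => by
    rcases lt_or_ge (d j) 0 with h | h
    · have := (le_div_iff₀ (neg_pos.2 h)).1 (hmin j h)
      linarith
    · exact add_nonneg (hp0 j) (mul_nonneg ht0 h)
  have hqj₀ : p j₀ + t * d j₀ = 0 := by
    rw [ht]
    field_simp [hj₀.ne]
    ring
  have hpj₀ : p j₀ ≠ 0 := fun h => hj₀.ne (hd_supp _ h)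
  obtain ⟨j₁, hj₁, hne⟩ : ∃ j₁ ∈ ({j | p j ≠ 0} : Finset ι), j₁ ≠ j₀ :=
    exists_mem_ne (lt_of_le_of_lt Fintype.card_pos hcard) j₀
  replace hj₁ : p j₁ ≠ 0 := by simpa using hj₁
  set s := -(t * ∑ j, d j) with hs
  have hs0 : 0 ≤ s := by
    have := mul_nonneg ht0 (neg_nonneg.2 hd_sum)
    linarith
  refine ⟨fun j => p j + t * d j + (Pi.single j₁ s : ι → ℝ) j, ⟨fun j => ?_, ?_⟩, ?_, fun i => ?_⟩
  · have hsingle : (0 : ι → ℝ) ≤ Pi.single j₁ s := Pi.single_nonneg.2 hs0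
    exact add_nonneg (hq0 j) (hsingle j)
  · simp only [sum_add_distrib, ← mul_sum, hp1, mem_univ, if_true, Pi.single_apply, sum_ite_eq']
    linarith
  · refine card_lt_card ((ssubset_iff_of_subset fun j => ?_).2 ⟨j₀, ?_, ?_⟩)
    · simp only [mem_filter, mem_univ, true_and]
      refine mt fun hj => ?_
      have : j ≠ j₁ := by rintro rfl; exact hj₁ hj
      simp [hj, hd_supp j hj, this]
    · simpa using hpj₀
    · simp [hqj₀, hne.symm]
  · have h : ∑ j, a i j * (p j + t * d j + (Pi.single j₁ s : ι → ℝ) j) =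
        ∑ j, a i j * p j + t * ∑ j, a i j * d j + a i j₁ * s := by
      simp only [mul_add, sum_add_distrib, mul_sum, Pi.single_apply, mul_ite, mul_zero, sum_ite_eq',
        mem_univ, if_true, mul_left_comm]
    rw [h, hd_ker i]
    have := mul_nonneg (ha i j₁) hs0
    linarith

open Finset in
/-- Every point of the standard simplex is dominated, with respect to finitely many nonnegative
linear forms, by a point with at most as many nonzero coordinates as there are forms. -/
lemma exists_mem_stdSimplex_card_support_le {ι κ : Type*} [Fintype ι] [DecidableEq ι] [Fintype κ]
    [Nonempty κ] (a : κ → ι → ℝ) (ha : ∀ i j, 0 ≤ a i j) {p : ι → ℝ} (hp : p ∈ stdSimplex ℝ ι) :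
    ∃ q ∈ stdSimplex ℝ ι, #{j | q j ≠ 0} ≤ Fintype.card κ ∧
      ∀ i, ∑ j, a i j * p j ≤ ∑ j, a i j * q j := by
  induction h : #{j | p j ≠ 0} using Nat.strong_induction_on generalizing p with
  | _ n ih =>
    subst h
    rcases le_or_gt #{j | p j ≠ 0} (Fintype.card κ) with hle | hlt
    · exact ⟨p, hp, hle, fun _ => le_rfl⟩
    · obtain ⟨q, hq, hqlt, hpq⟩ := exists_mem_stdSimplex_card_support_lt a ha hp hlt
      obtain ⟨r, hr, hrle, hqr⟩ := ih _ hqlt hq rfl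
      exact ⟨r, hr, hrle, fun i => (hpq i).trans (hqr i)⟩

/-- Corollary 1 (sparse optimizers of a min of diagonal quadratic forms): the
problem `max_{‖c‖²=1} min_{1≤i≤k} ∑_j θ_i(j)²·c(j)²` has a global optimal
solution supported on at most `k` coordinates. -/
theorem sparse_optimal_min_diagonal_quadratic
    (M k : ℕ) (hM : 1 ≤ M) (hk : 1 ≤ k)
    (θ : Fin k → Fin M → ℝ) :
    ∃ cstar : Fin M → ℝ,
      (∑ j, cstar j ^ 2 = 1) ∧
      ({ j | cstar j ≠ 0 } : Set (Fin M)).ncard ≤ k ∧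
      ∀ c : Fin M → ℝ, (∑ j, c j ^ 2 = 1) →
        (Finset.univ.inf' ⟨⟨0, hk⟩, Finset.mem_univ _⟩
            fun i : Fin k => ∑ j, (θ i j) ^ 2 * c j ^ 2)
          ≤ Finset.univ.inf' ⟨⟨0, hk⟩, Finset.mem_univ _⟩
            fun i : Fin k => ∑ j, (θ i j) ^ 2 * cstar j ^ 2 := by
  have : Nonempty (Fin k) := ⟨⟨0, hk⟩⟩
  have hne : (Finset.univ : Finset (Fin k)).Nonempty := Finset.univ_nonempty
  have hcont : Continuous fun p : Fin M → ℝ =>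
      Finset.univ.inf' hne fun i : Fin k => ∑ j, θ i j ^ 2 * p j :=
    Continuous.finset_inf'_apply hne fun i _ => by fun_prop
  obtain ⟨p, hp, hmax⟩ := (isCompact_stdSimplex ℝ (Fin M)).exists_isMaxOn
    ⟨_, single_mem_stdSimplex ℝ (⟨0, hM⟩ : Fin M)⟩ hcont.continuousOn
  obtain ⟨q, hq, hcard, hpq⟩ :=
    exists_mem_stdSimplex_card_support_le (fun i j => θ i j ^ 2) (fun _ _ => sq_nonneg _) hp
  have hsq : ∀ j, √(q j) ^ 2 = q j := fun j => Real.sq_sqrt (hq.1 j)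
  refine ⟨fun j => √(q j), by simpa only [hsq] using hq.2, ?_, fun c hc => ?_⟩
  · have hset : {j | √(q j) ≠ 0} = (({j | q j ≠ 0} : Finset (Fin M)) : Set (Fin M)) := by
      ext j
      simp [Real.sqrt_eq_zero (hq.1 j)]
    rw [hset, Set.ncard_coe_finset]
    simpa using hcard
  · simp only [hsq]
    exact (hmax (show (fun j => c j ^ 2) ∈ stdSimplex ℝ (Fin M) from
      ⟨fun j => sq_nonneg _, hc⟩)).trans (Finset.inf'_mono_fun fun i _ => hpq i)
end

section
/- Theorem 1, part (c), case K = 2 (single direction suffices for two users): Let X, Y be nonempty finite sets and let B₁, B₂ be real matrices indexed by Y × X such that each B_i is a contraction (∑_y ((B_iψ)(y))² ≤ ∑_x ψ(x)² for every ψ : X → ℝ) and B_iᵀ·(B_i·v₀) = v₀ for a fixed unit vector v₀ : X → ℝ. Then for every n ≥ 1 and every ψ : (Fin n → X) → ℝ with ‖ψ‖ = 1 and ⟨ψ, v₀^(n)⟩ = 0, there exists φ : X → ℝ with ‖φ‖ = 1 and ⟨φ, v₀⟩ = 0 such that min(‖B₁^(n)·ψ‖², ‖B₂^(n)·ψ‖²)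 ≤ min(‖B₁·φ‖², ‖B₂·φ‖²). In other words, with a binary auxiliary variable and both perturbations along one direction, λ_B^(n) = λ_B^(1) for every n when K = 2. -/
open Finset Matrix

/-- Two homogeneous linear inequalities in the plane have a common nonzero solution, which may be
written as a complex square. -/
theorem exists_sq_direction (α p β r : ℝ) :
    ∃ c s : ℝ, (c ≠ 0 ∨ s ≠ 0) ∧ 0 ≤ α * (c ^ 2 - s ^ 2) + p * (2 * c * s) ∧
      0 ≤ β * (c ^ 2 - s ^ 2) + r * (2 * c * s) := by
  obtain ⟨x, y, hxy, h₁, h₂⟩ : ∃ x y : ℝ, (x ≠ 0 ∨ y ≠ 0) ∧ 0 ≤ α * x + p * y ∧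
      0 ≤ β * x + r * y := by
    by_cases h : α = 0 ∧ p = 0
    · by_cases h' : β = 0 ∧ r = 0
      · exact ⟨1, 0, by simp, by simp [h], by simp [h']⟩
      · exact ⟨β, r, by tauto, by simp [h], by nlinarith [sq_nonneg β, sq_nonneg r]⟩
    · rcases le_total 0 (β * -p + r * α) with h' | h'
      · exact ⟨-p, α, by simp only [ne_eq, neg_eq_zero]; tauto, by linarith, h'⟩
      · exact ⟨p, -α, by simp only [ne_eq, neg_eq_zero]; tauto, by linarith, by linarith⟩
  obtain ⟨z, hz⟩ := IsAlgClosed.exists_pow_nat_eq (⟨x, y⟩ : ℂ) two_pos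
  have hx : z.re ^ 2 - z.im ^ 2 = x := by
    have := congrArg Complex.re hz
    simp only [sq, Complex.mul_re] at this ⊢
    exact this
  have hy : 2 * z.re * z.im = y := by
    have := congrArg Complex.im hz
    simp only [sq, Complex.mul_im] at this
    linarith
  refine ⟨z.re, z.im, ?_, by rwa [hx, hy], by rwa [hx, hy]⟩
  contrapose! hxy
  rw [← hx, ← hy, hxy.1, hxy.2]
  norm_num

namespace QuadraticMap

variable {V : Type*} [AddCommGroup V] [Module ℝ V]

theorem map_smul_add_smul (Q : QuadraticForm ℝ V) (c s : ℝ) (u w : V) :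
    Q (c • u + s • w) = c ^ 2 * Q u + s ^ 2 * Q w + c * s * polar Q u w := by
  rw [QuadraticMap.map_add Q, polar_smul_left, polar_smul_right, QuadraticMap.map_smul,
    QuadraticMap.map_smul]
  simp only [smul_eq_mul]
  ring

/-- For two quadratic forms, two vectors can be replaced by a single one of the same total norm
at which neither form decreases. -/
theorem PosDef.exists_add_le {N : QuadraticForm ℝ V} (hN : N.PosDef) (Q₁ Q₂ : QuadraticForm ℝ V)
    (u w : V) : ∃ φ : V, N φ = N u + N w ∧ Q₁ u + Q₁ w ≤ Q₁ φ ∧ Q₂ u + Q₂ w ≤ Q₂ φ := by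
  rcases eq_or_ne u 0 with rfl | hu
  · exact ⟨w, by simp⟩
  have hNu : 0 < N u := hN u hu
  have hT : 0 < N u + N w := add_pos_of_pos_of_nonneg hNu (hN.nonneg w)
  suffices h : ∃ φ : V, φ ≠ 0 ∧ (Q₁ u + Q₁ w) * N φ ≤ (N u + N w) * Q₁ φ ∧
      (Q₂ u + Q₂ w) * N φ ≤ (N u + N w) * Q₂ φ by
    obtain ⟨φ, hφ, h₁, h₂⟩ := h
    have hNφ : 0 < N φ := hN φ hφ
    have hk : √((N u + N w) / N φ) * √((N u + N w) / N φ) = (N u + N w) / N φ :=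
      Real.mul_self_sqrt (by positivity)
    refine ⟨√((N u + N w) / N φ) • φ, ?_, ?_, ?_⟩
    · rw [QuadraticMap.map_smul, hk, smul_eq_mul, div_mul_cancel₀ _ hNφ.ne']
    · rw [QuadraticMap.map_smul, hk, smul_eq_mul, div_mul_eq_mul_div, le_div_iff₀ hNφ]
      exact h₁
    · rw [QuadraticMap.map_smul, hk, smul_eq_mul, div_mul_eq_mul_div, le_div_iff₀ hNφ]
      exact h₂
  obtain ⟨c, s, hcs, h₁, h₂⟩ := exists_sq_direction
    (N w * Q₁ u - N u * Q₁ w)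
    (((N u + N w) * polar Q₁ u w - (Q₁ u + Q₁ w) * polar N u w) / 2)
    (N w * Q₂ u - N u * Q₂ w)
    (((N u + N w) * polar Q₂ u w - (Q₂ u + Q₂ w) * polar N u w) / 2)
  by_cases h0 : c • u + s • w = 0
  · have hs : s ≠ 0 := by
      rintro rfl
      simp_all
    obtain ⟨k, rfl⟩ : ∃ k : ℝ, w = k • u :=
      ⟨-(s⁻¹ * c), by
        rw [neg_smul, mul_smul, eq_neg_of_add_eq_zero_left h0, smul_neg, neg_neg,
          inv_smul_smul₀ hs]⟩
    refine ⟨u, hu, le_of_eq ?_, le_of_eq ?_⟩ <;>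
    · simp only [QuadraticMap.map_smul, smul_eq_mul]
      ring
  · refine ⟨_, h0, ?_, ?_⟩ <;>
    · simp only [map_smul_add_smul]
      linarith

theorem PosDef.exists_sum_le {ι : Type*} {N : QuadraticForm ℝ V} (hN : N.PosDef)
    (Q₁ Q₂ : QuadraticForm ℝ V) (S : Finset ι) (u : ι → V) :
    ∃ φ : V, N φ = ∑ i ∈ S, N (u i) ∧ ∑ i ∈ S, Q₁ (u i) ≤ Q₁ φ ∧ ∑ i ∈ S, Q₂ (u i) ≤ Q₂ φ := by
  classical
  induction S using Finset.induction_on with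
  | empty => exact ⟨0, by simp⟩
  | insert a S ha ih =>
    obtain ⟨φ, h, h₁, h₂⟩ := ih
    obtain ⟨φ', h', h₁', h₂'⟩ := hN.exists_add_le Q₁ Q₂ (u a) φ
    simp only [sum_insert ha]
    exact ⟨φ', by rw [h', h], by linarith, by linarith⟩

end QuadraticMap

namespace Matrix

variable {X Y : Type*} [Fintype X] [Fintype Y]

/-- The sum of squares of the coordinates. -/
noncomputable def sumSq (X : Type*) [Fintype X] : QuadraticForm ℝ (X → ℝ) :=
  QuadraticMap.weightedSumSquares ℝ fun _ : X => (1 : ℝ)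

theorem sumSq_apply (v : X → ℝ) : sumSq X v = ∑ x, v x ^ 2 := by
  simp [sumSq, QuadraticMap.weightedSumSquares_apply, sq]

theorem posDef_sumSq : (sumSq X).PosDef := by
  intro v hv
  rw [sumSq_apply]
  obtain ⟨x, hx⟩ := Function.ne_iff.mp hv
  exact sum_pos' (fun x _ => sq_nonneg _) ⟨x, mem_univ x, sq_pos_iff.2 hx⟩

/-- The quadratic form `v ↦ ‖B v‖²`. -/
noncomputable def energy (B : Matrix Y X ℝ) : QuadraticForm ℝ (X → ℝ) :=
  (sumSq Y).comp B.mulVecLin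

theorem energy_apply (B : Matrix Y X ℝ) (v : X → ℝ) : B.energy v = ∑ y, (B *ᵥ v) y ^ 2 := by
  simp [energy, sumSq_apply]

/-- The `n`-th Kronecker power, indexed by functions on `Fin n`. -/
def kroneckerPow (B : Matrix Y X ℝ) (n : ℕ) : Matrix (Fin n → Y) (Fin n → X) ℝ :=
  Matrix.of fun r c => ∏ j, B (r j) (c j)

theorem sum_fin_succ_fun {n : ℕ} (f : (Fin (n + 1) → X) → ℝ) :
    ∑ c, f c = ∑ c : Fin n → X, ∑ x, f (Fin.cons x c) := by
  rw [← (Fin.consEquiv fun _ => X).sum_comp, Fintype.sum_prod_type_right]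
  rfl

/-- The `(n + 1)`-st Kronecker power applies the `n`-th one to the last `n` letters, then `B` to
the first. -/
theorem kroneckerPow_succ_mulVec {Y : Type*} (B : Matrix Y X ℝ) {n : ℕ}
    (ψ : (Fin (n + 1) → X) → ℝ) (y : Y) (r : Fin n → Y) :
    (B.kroneckerPow (n + 1) *ᵥ ψ) (Fin.cons y r) =
      (B *ᵥ fun x => (B.kroneckerPow n *ᵥ fun c => ψ (Fin.cons x c)) r) y := by
  simp only [mulVec, dotProduct, kroneckerPow, of_apply]
  rw [sum_fin_succ_fun, sum_comm]
  refine sum_congr rfl fun x _ => ?_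
  rw [mul_sum]
  refine sum_congr rfl fun c _ => ?_
  simp only [Fin.prod_univ_succ, Fin.cons_zero, Fin.cons_succ]
  ring

theorem energy_kroneckerPow_succ (B : Matrix Y X ℝ) {n : ℕ} (ψ : (Fin (n + 1) → X) → ℝ) :
    (B.kroneckerPow (n + 1)).energy ψ =
      ∑ r, B.energy fun x => (B.kroneckerPow n *ᵥ fun c => ψ (Fin.cons x c)) r := by
  simp only [energy_apply]
  rw [sum_fin_succ_fun]
  simp only [kroneckerPow_succ_mulVec]

theorem energy_kroneckerPow_le {B : Matrix Y X ℝ} (hB : ∀ v, B.energy v ≤ sumSq X v) (n : ℕ)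
    (ψ : (Fin n → X) → ℝ) : (B.kroneckerPow n).energy ψ ≤ sumSq _ ψ := by
  induction n with
  | zero => simp [energy_apply, sumSq_apply, kroneckerPow, mulVec, dotProduct]
  | succ n ih =>
    calc (B.kroneckerPow (n + 1)).energy ψ
        ≤ ∑ r, sumSq X fun x => (B.kroneckerPow n *ᵥ fun c => ψ (Fin.cons x c)) r := by
          rw [energy_kroneckerPow_succ]
          exact sum_le_sum fun r _ => hB _
      _ = ∑ x, (B.kroneckerPow n).energy fun c => ψ (Fin.cons x c) := by
          simp only [energy_apply, sumSq_apply]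
          exact sum_comm
      _ ≤ ∑ x, sumSq _ fun c : Fin n → X => ψ (Fin.cons x c) := sum_le_sum fun x _ => ih _
      _ = sumSq _ ψ := by
          simp only [sumSq_apply]
          rw [sum_fin_succ_fun, sum_comm]

/-- The hyperplane orthogonal to `v`. -/
def orthogonalHyperplane (v : X → ℝ) : Submodule ℝ (X → ℝ) :=
  LinearMap.ker (dotProductBilin ℝ ℝ v)

theorem mem_orthogonalHyperplane {v φ : X → ℝ} :
    φ ∈ orthogonalHyperplane v ↔ φ ⬝ᵥ v = 0 := by
  rw [dotProduct_comm]; rfl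

theorem sumSq_add_smul {v h : X → ℝ} (hv : sumSq X v = 1) (hh : h ⬝ᵥ v = 0) (t : ℝ) :
    sumSq X (h + t • v) = sumSq X h + t ^ 2 := by
  have h1 : sumSq X (h + t • v) = sumSq X h + 2 * t * (h ⬝ᵥ v) + t ^ 2 * sumSq X v := by
    simp only [sumSq_apply, dotProduct, mul_sum, ← sum_add_distrib]
    refine sum_congr rfl fun x _ => ?_
    simp only [Pi.add_apply, Pi.smul_apply, smul_eq_mul]
    ring
  rw [h1, hv, hh]
  ring

theorem energy_add_smul {B : Matrix Y X ℝ} {v h : X → ℝ} (hv : sumSq X v = 1)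
    (hfix : Bᵀ *ᵥ (B *ᵥ v) = v) (hh : h ⬝ᵥ v = 0) (t : ℝ) :
    B.energy (h + t • v) = B.energy h + t ^ 2 := by
  have key (w : X → ℝ) : (B *ᵥ w) ⬝ᵥ (B *ᵥ v) = w ⬝ᵥ v := by
    rw [dotProduct_comm, dotProduct_mulVec, ← mulVec_transpose, hfix, dotProduct_comm]
  have h1 : sumSq Y (B *ᵥ v) = 1 := by
    rw [← hv, sumSq_apply, sumSq_apply]
    simpa only [dotProduct, ← sq] using key v
  calc B.energy (h + t • v) = sumSq Y (B *ᵥ h + t • B *ᵥ v) := by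
        rw [← mulVec_smul, ← mulVec_add]; rfl
    _ = _ := sumSq_add_smul h1 ((key h).trans hh) t

/-- The component along `v` of the first letter of `ψ`. -/
def firstComponent (v : X → ℝ) {n : ℕ} (ψ : (Fin (n + 1) → X) → ℝ) (c : Fin n → X) : ℝ :=
  (fun x => ψ (Fin.cons x c)) ⬝ᵥ v

/-- The component orthogonal to `v` of the first letter of `ψ`. -/
def firstResidual (v : X → ℝ) {n : ℕ} (ψ : (Fin (n + 1) → X) → ℝ) (c : Fin n → X) : X → ℝ :=
  (fun x => ψ (Fin.cons x c)) - firstComponent v ψ c • v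

section

variable {v : X → ℝ} {n : ℕ}

theorem firstResidual_dotProduct (hv : sumSq X v = 1) (ψ : (Fin (n + 1) → X) → ℝ)
    (c : Fin n → X) : firstResidual v ψ c ⬝ᵥ v = 0 := by
  have h : v ⬝ᵥ v = 1 := by rw [← hv, sumSq_apply]; simp only [dotProduct, sq]
  simp [firstResidual, firstComponent, sub_dotProduct, h]

theorem firstResidual_add (ψ : (Fin (n + 1) → X) → ℝ) (c : Fin n → X) :
    firstResidual v ψ c + firstComponent v ψ c • v = fun x => ψ (Fin.cons x c) :=
  sub_add_cancel _ _

theorem sumSq_eq_firstResidual_add (hv : sumSq X v = 1) (ψ : (Fin (n + 1) → X) → ℝ) :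
    sumSq _ ψ = ∑ c, sumSq X (firstResidual v ψ c) + sumSq _ (firstComponent v ψ) := by
  rw [sumSq_apply, sum_fin_succ_fun, sumSq_apply (firstComponent v ψ), ← sum_add_distrib]
  refine sum_congr rfl fun c _ => ?_
  rw [← sumSq_add_smul hv (firstResidual_dotProduct hv ψ c), firstResidual_add, sumSq_apply]

theorem energy_kroneckerPow_succ_le {B : Matrix Y X ℝ} (hB : ∀ v, B.energy v ≤ sumSq X v)
    (hv : sumSq X v = 1) (hfix : Bᵀ *ᵥ (B *ᵥ v) = v) (ψ : (Fin (n + 1) → X) → ℝ) :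
    (B.kroneckerPow (n + 1)).energy ψ ≤
      ∑ c, B.energy (firstResidual v ψ c) + (B.kroneckerPow n).energy (firstComponent v ψ) := by
  let h (r : Fin n → Y) : X → ℝ := ∑ c, B.kroneckerPow n r c • firstResidual v ψ c
  have hh (r) : h r ⬝ᵥ v = 0 := by
    simp [h, sum_dotProduct, smul_dotProduct, firstResidual_dotProduct hv]
  have hsplit (r : Fin n → Y) : (fun x => (B.kroneckerPow n *ᵥ fun c => ψ (Fin.cons x c)) r) =
      h r + (B.kroneckerPow n *ᵥ firstComponent v ψ) r • v := by
    ext x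
    simp only [h, mulVec, dotProduct, Pi.add_apply, Pi.smul_apply, Finset.sum_apply, smul_eq_mul,
      sum_mul, ← sum_add_distrib]
    refine sum_congr rfl fun c _ => ?_
    rw [← congrFun (firstResidual_add (v := v) ψ c) x]
    simp only [Pi.add_apply, Pi.smul_apply, smul_eq_mul]
    ring
  have hmul (r : Fin n → Y) (y : Y) :
      (B *ᵥ h r) y = (B.kroneckerPow n *ᵥ fun c => (B *ᵥ firstResidual v ψ c) y) r := by
    simp only [h, mulVec_sum, mulVec_smul, Finset.sum_apply, Pi.smul_apply, smul_eq_mul]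
    rfl
  calc (B.kroneckerPow (n + 1)).energy ψ
      = ∑ r, B.energy (h r) + (B.kroneckerPow n).energy (firstComponent v ψ) := by
        rw [energy_kroneckerPow_succ, energy_apply (B.kroneckerPow n), ← sum_add_distrib]
        refine sum_congr rfl fun r _ => ?_
        rw [hsplit, energy_add_smul hv hfix (hh r)]
    _ = ∑ y, (B.kroneckerPow n).energy (fun c => (B *ᵥ firstResidual v ψ c) y) +
          (B.kroneckerPow n).energy (firstComponent v ψ) := by
        simp only [energy_apply, hmul]
        rw [sum_comm]
    _ ≤ ∑ y, sumSq _ (fun c => (B *ᵥ firstResidual v ψ c) y) +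
          (B.kroneckerPow n).energy (firstComponent v ψ) := by
        gcongr with y
        exact energy_kroneckerPow_le hB n _
    _ = _ := by
        simp only [sumSq_apply, energy_apply B]
        rw [sum_comm]

theorem firstComponent_dotProduct (ψ : (Fin (n + 1) → X) → ℝ) :
    (firstComponent v ψ ⬝ᵥ fun c => ∏ j, v (c j)) = ψ ⬝ᵥ fun c => ∏ j, v (c j) := by
  simp only [firstComponent, dotProduct]
  rw [sum_fin_succ_fun]
  refine sum_congr rfl fun c _ => ?_
  rw [sum_mul]
  refine sum_congr rfl fun x _ => ?_
  simp only [Fin.prod_univ_succ, Fin.cons_zero, Fin.cons_succ]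
  ring

end

/-- A vector on `n` letters orthogonal to `v^(n)` is dominated, for two contractions at once, by a
vector on one letter orthogonal to `v`. -/
theorem exists_energy_kroneckerPow_le {B₁ B₂ : Matrix Y X ℝ}
    (hB₁ : ∀ v, B₁.energy v ≤ sumSq X v) (hB₂ : ∀ v, B₂.energy v ≤ sumSq X v)
    {v : X → ℝ} (hv : sumSq X v = 1)
    (hfix₁ : B₁ᵀ *ᵥ (B₁ *ᵥ v) = v) (hfix₂ : B₂ᵀ *ᵥ (B₂ *ᵥ v) = v)
    (n : ℕ) (ψ : (Fin n → X) → ℝ) (horth : (ψ ⬝ᵥ fun c => ∏ j, v (c j)) = 0) :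
    ∃ φ : orthogonalHyperplane v, sumSq X φ = sumSq _ ψ ∧
      (B₁.kroneckerPow n).energy ψ ≤ B₁.energy φ ∧
      (B₂.kroneckerPow n).energy ψ ≤ B₂.energy φ := by
  have hN : ((sumSq X).comp (orthogonalHyperplane v).subtype).PosDef := fun φ hφ =>
    posDef_sumSq _ (by simpa using hφ)
  let Q (B : Matrix Y X ℝ) := B.energy.comp (orthogonalHyperplane v).subtype
  induction n with
  | zero =>
    obtain rfl : ψ = 0 := by
      ext c
      simpa [dotProduct, Subsingleton.elim c default] using horth
    exact ⟨0, by simp⟩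
  | succ n ih =>
    obtain ⟨φ, h, h₁, h₂⟩ := ih (firstComponent v ψ) ((firstComponent_dotProduct ψ).trans horth)
    obtain ⟨φ', h', h₁', h₂'⟩ := hN.exists_sum_le (Q B₁) (Q B₂) univ fun c =>
      ⟨firstResidual v ψ c, mem_orthogonalHyperplane.2 (firstResidual_dotProduct hv ψ c)⟩
    obtain ⟨φ'', h'', h₁'', h₂''⟩ := hN.exists_add_le (Q B₁) (Q B₂) φ' φ
    simp only [Q, QuadraticMap.comp_apply, Submodule.subtype_apply] at *
    refine ⟨φ'', ?_, ?_, ?_⟩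
    · rw [h'', h', h, sumSq_eq_firstResidual_add hv]
    · linarith [energy_kroneckerPow_succ_le hB₁ hv hfix₁ ψ]
    · linarith [energy_kroneckerPow_succ_le hB₂ hv hfix₂ ψ]

end Matrix

/-- Theorem 1, part (c), case K = 2: for two users, a single perturbation
direction suffices and single-letter solutions are optimal. If `B₁, B₂` are
contractions fixing the unit vector `v₀`, then for every `n ≥ 1` and every unit
`ψ` on `n` letters orthogonal to `v₀^(n)`, there is a single-letter unit vector
`φ` orthogonal to `v₀` with
`min(‖B₁^(n)ψ‖², ‖B₂^(n)ψ‖²) ≤ min(‖B₁φ‖², ‖B₂φ‖²)`. -/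
theorem broadcast_two_user_single_direction_single_letter
    {X Y : Type*} [Fintype X] [Fintype Y] [Nonempty X] [Nonempty Y]
    (B₁ B₂ : Matrix Y X ℝ)
    (hcontr₁ : ∀ ψ : X → ℝ, ∑ y, (B₁.mulVec ψ y) ^ 2 ≤ ∑ x, ψ x ^ 2)
    (hcontr₂ : ∀ ψ : X → ℝ, ∑ y, (B₂.mulVec ψ y) ^ 2 ≤ ∑ x, ψ x ^ 2)
    (v₀ : X → ℝ) (hv₀ : ∑ x, v₀ x ^ 2 = 1)
    (hfix₁ : B₁.transpose.mulVec (B₁.mulVec v₀) = v₀)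
    (hfix₂ : B₂.transpose.mulVec (B₂.mulVec v₀) = v₀)
    (n : ℕ) (hn : 1 ≤ n)
    (ψ : (Fin n → X) → ℝ)
    (hunit : ∑ c : Fin n → X, ψ c ^ 2 = 1)
    (horth : ∑ c : Fin n → X, ψ c * ∏ j, v₀ (c j) = 0) :
    ∃ φ : X → ℝ,
      (∑ x, φ x ^ 2 = 1) ∧
      (∑ x, φ x * v₀ x = 0) ∧
      min
          (∑ r : Fin n → Y,
            ((Matrix.of fun (r : Fin n → Y) (c : Fin n → X) =>
                ∏ j, B₁ (r j) (c j)).mulVec ψ r) ^ 2)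
          (∑ r : Fin n → Y,
            ((Matrix.of fun (r : Fin n → Y) (c : Fin n → X) =>
                ∏ j, B₂ (r j) (c j)).mulVec ψ r) ^ 2)
        ≤ min (∑ y, (B₁.mulVec φ y) ^ 2) (∑ y, (B₂.mulVec φ y) ^ 2) := by
  have hN : sumSq X v₀ = 1 := by rw [sumSq_apply, hv₀]
  obtain ⟨φ, h, h₁, h₂⟩ := exists_energy_kroneckerPow_le (B₁ := B₁) (B₂ := B₂)
    (fun v => by simpa only [energy_apply, sumSq_apply] using hcontr₁ v)
    (fun v => by simpa only [energy_apply, sumSq_apply] using hcontr₂ v)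
    hN hfix₁ hfix₂ n ψ horth
  rw [sumSq_apply, sumSq_apply, hunit] at h
  rw [energy_apply, energy_apply] at h₁ h₂
  exact ⟨φ, h, mem_orthogonalHyperplane.1 φ.2, min_le_min h₁ h₂⟩
end

section
/- Theorem 2, part 2 (blocks of the optimal MAC perturbation are individually orthogonal): Let k ≥ 1, let X₁,…,X_k and Y be nonempty finite sets, let B_i be a real matrix indexed by Y × X_i for each i, let w₀ : Y → ℝ be a unit vector, and let v_i : X_i → ℝ be unit vectors satisfying B_i·v_i = w₀ and B_iᵀ·w₀ = v_i for every i. Let B₀ = [B₁ … B_k] be the block matrix indexed by Y × (Σ_i X_i) with B₀(y,(i,x)) = B_i(y,x) and let v̄(i,x) = v_i(x). Suppose ψ : (Σ_i X_i) → ℝ satisfies ‖ψ‖ = 1, ⟨ψ, v̄⟩ = 0, B₀·ψ ≠ 0, and ψ is a maximizer: ‖B₀·φ‖ ≤ ‖B₀·ψ‖ for every φ with ‖φ‖ = 1 and ⟨φ, v̄⟩ = 0 (so ψ is a right singular vector of B₀ for the second largest singular value, assumed nonzero). Then each block of ψ is orthogonal to the corresponding v_i: for every i, ∑_{x ∈ X_i}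 v_i(x)·ψ(i,x) = 0. -/
/-- Theorem 2, part 2: if `ψ` is a maximizer of `‖B₀·ψ‖` over unit vectors
orthogonal to `v̄` (with nonzero image), i.e. a right singular vector of the
block matrix `B₀ = [B₁ … B_k]` for its second largest singular value (assumed
nonzero), then each block `ψ_i` of `ψ` is orthogonal to the corresponding
vector `v_i`. -/
theorem mac_optimal_perturbation_blocks_orthogonal
    (k : ℕ) (hk : 1 ≤ k) {Y : Type*} [Fintype Y] [Nonempty Y]
    (X : Fin k → Type*) [∀ i, Fintype (X i)] [∀ i, Nonempty (X i)]
    (B : ∀ i, Matrix Y (X i) ℝ)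
    (w₀ : Y → ℝ) (hw₀ : ∑ y, w₀ y ^ 2 = 1)
    (v : ∀ i, X i → ℝ) (hv : ∀ i, ∑ x, v i x ^ 2 = 1)
    (hBv : ∀ i, (B i).mulVec (v i) = w₀)
    (hBw : ∀ i, (B i).transpose.mulVec w₀ = v i)
    (ψ : (Σ i, X i) → ℝ)
    (hψ1 : ∑ p : Σ i, X i, ψ p ^ 2 = 1)
    (hψ2 : ∑ p : Σ i, X i, ψ p * v p.1 p.2 = 0)
    (hne : (fun y => ∑ p : Σ i, X i, B p.1 y p.2 * ψ p) ≠ 0)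
    (hmax : ∀ φ : (Σ i, X i) → ℝ, (∑ p : Σ i, X i, φ p ^ 2 = 1) →
        (∑ p : Σ i, X i, φ p * v p.1 p.2 = 0) →
        ∑ y, (∑ p : Σ i, X i, B p.1 y p.2 * φ p) ^ 2
          ≤ ∑ y, (∑ p : Σ i, X i, B p.1 y p.2 * ψ p) ^ 2) :
    ∀ i, ∑ x, v i x * ψ ⟨i, x⟩ = 0 := by
  intro i
  set c : Fin k → ℝ := fun i => ∑ x, v i x * ψ ⟨i, x⟩ with hc
  set χ : (Σ i, X i) → ℝ := fun p => ψ p - c p.1 * v p.1 p.2 with hχ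
  have hc0 : ∑ i, c i = 0 := by
    rw [← hψ2, Fintype.sum_sigma]
    simp only [hc, mul_comm]
  have hBχ : ∀ y, ∑ p : Σ i, X i, B p.1 y p.2 * χ p
      = ∑ p : Σ i, X i, B p.1 y p.2 * ψ p := by
    intro y
    have hy : ∑ p : Σ i, X i, B p.1 y p.2 * (c p.1 * v p.1 p.2) = 0 := by
      rw [Fintype.sum_sigma]
      have hblock : ∀ i, ∑ x, B i y x * (c i * v i x) = c i * w₀ y := by
        intro i
        rw [← hBv i, Matrix.mulVec, dotProduct, Finset.mul_sum]
        exact Finset.sum_congr rfl fun x _ => by ring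
      simp only [hblock, ← Finset.sum_mul, hc0, zero_mul]
    simp only [hχ, mul_sub, Finset.sum_sub_distrib, hy, sub_zero]
  have hχv : ∑ p : Σ i, X i, χ p * v p.1 p.2 = 0 := by
    have hcv : ∑ p : Σ i, X i, c p.1 * v p.1 p.2 * v p.1 p.2 = 0 := by
      rw [Fintype.sum_sigma]
      simp only [mul_assoc, ← Finset.mul_sum, ← pow_two, hv, mul_one, hc0]
    simp only [hχ, sub_mul, Finset.sum_sub_distrib, hψ2, hcv, sub_zero]
  have hχnorm : ∑ p : Σ i, X i, χ p ^ 2 = 1 - ∑ i, c i ^ 2 := by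
    rw [← hψ1, Fintype.sum_sigma, Fintype.sum_sigma, ← Finset.sum_sub_distrib]
    refine Finset.sum_congr rfl fun i _ => ?_
    have hexpand : ∀ x, χ ⟨i, x⟩ ^ 2
        = ψ ⟨i, x⟩ ^ 2 - 2 * c i * (v i x * ψ ⟨i, x⟩) + c i ^ 2 * v i x ^ 2 := by
      intro x
      simp only [hχ]
      ring
    simp only [hexpand, Finset.sum_add_distrib, Finset.sum_sub_distrib, ← Finset.mul_sum, hv]
    change _ - 2 * c i * c i + _ = _
    ring
  set N : ℝ := ∑ p : Σ i, X i, χ p ^ 2 with hN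
  have hM : 0 < ∑ y, (∑ p : Σ i, X i, B p.1 y p.2 * ψ p) ^ 2 := by
    obtain ⟨y, hy⟩ := Function.ne_iff.mp hne
    exact Finset.sum_pos' (fun _ _ => sq_nonneg _) ⟨y, Finset.mem_univ y, sq_pos_of_ne_zero hy⟩
  have hNpos : 0 < N := by
    refine (Finset.sum_nonneg fun _ _ => sq_nonneg _).lt_of_ne' fun hN0 => hne ?_
    have hχ0 : ∀ p, χ p = 0 := fun p =>
      pow_eq_zero_iff two_ne_zero |>.mp <|
        (Finset.sum_eq_zero_iff_of_nonneg fun _ _ => sq_nonneg _).mp hN0 p (Finset.mem_univ p)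
    funext y
    simp [← hBχ, hχ0]
  have hs : (√N)⁻¹ ^ 2 = N⁻¹ := by rw [inv_pow, Real.sq_sqrt hNpos.le]
  have hle := hmax (fun p => (√N)⁻¹ * χ p)
    (by simp only [mul_pow, hs, ← Finset.mul_sum, ← hN, inv_mul_cancel₀ hNpos.ne'])
    (by simp only [mul_assoc, ← Finset.mul_sum, hχv, mul_zero])
  simp only [mul_left_comm _ (√N)⁻¹, ← Finset.mul_sum, mul_pow, hs, hBχ] at hle
  have hN1 : 1 ≤ N := (inv_le_one₀ hNpos).mp ((mul_le_iff_le_one_left hM).mp hle)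
  have hci : c i ^ 2 ≤ ∑ i, c i ^ 2 :=
    Finset.single_le_sum (f := fun i => c i ^ 2) (fun _ _ => sq_nonneg _) (Finset.mem_univ i)
  exact pow_eq_zero_iff two_ne_zero |>.mp (le_antisymm (by linarith) (sq_nonneg (c i)))
end

section
/- Existence of a single combining direction (inequality (eq:gamma) in the proof of Theorem 1(c)): Let m ≥ 1, let s, t : Fin m → ℝ be the diagonal entries of diagonal matrices Σ = diag(s) and Ω = diag(t), let Φ be an m × m real orthogonal matrix (ΦᵀΦ = I), and let a, b : Fin m → ℝ satisfy ∑_j a(j)² + ∑_j b(j)² = 1. Then there exists a unit vector c : Fin m → ℝ (∑_j c(j)² = 1) such that ∑_j s(j)²·c(j)² ≥ ∑_j s(j)²·a(j)² + ∑_j s(j)²·b(j)² and ‖Ω·Φᵀ·c‖² ≥ ‖Ω·Φᵀ·a‖² + ‖Ω·Φᵀ·b‖², where ‖Ω·Φᵀ·x‖² = ∑_j t(j)²·(∑_i Φ(i,j)·x(i))². -/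
namespace QuadraticMap

variable {E : Type*} [AddCommGroup E] [Module ℝ E]

theorem apply_smul_add_smul (R : QuadraticForm ℝ E) (p q : ℝ) (a b : E) :
    R (p • a + q • b) = p ^ 2 * R a + q ^ 2 * R b + p * q * polar R a b := by
  rw [QuadraticMap.map_add R, QuadraticMap.map_smul, QuadraticMap.map_smul, polar_smul_left,
    polar_smul_right]
  simp only [smul_eq_mul]
  ring

theorem apply_rotation_add (R : QuadraticForm ℝ E) (θ : ℝ) (a b : E) :
    R (Real.cos θ • a + Real.sin θ • b) + R ((-Real.sin θ) • a + Real.cos θ • b) =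
      R a + R b := by
  rw [apply_smul_add_smul, apply_smul_add_smul]
  linear_combination (R a + R b) * Real.sin_sq_add_cos_sq θ

theorem exists_rotation_apply_eq_zero (R : QuadraticForm ℝ E) {a b : E} (h : R a + R b = 0) :
    ∃ θ : ℝ, R (Real.cos θ • a + Real.sin θ • b) = 0 := by
  have hcont : Continuous fun θ : ℝ => R (Real.cos θ • a + Real.sin θ • b) := by
    simp only [apply_smul_add_smul]
    fun_prop
  have h0 : R (Real.cos 0 • a + Real.sin 0 • b) = R a := by simp
  have h1 : R (Real.cos (Real.pi / 2) • a + Real.sin (Real.pi / 2) • b) = R b := by simp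
  rcases le_total (R a) 0 with ha | ha
  · exact mem_range_of_exists_le_of_exists_ge hcont ⟨0, by linarith⟩ ⟨Real.pi / 2, by linarith⟩
  · exact mem_range_of_exists_le_of_exists_ge hcont ⟨Real.pi / 2, by linarith⟩ ⟨0, by linarith⟩

/-- If the sum of the squared norms of `a` and `b` is one, then some unit vector dominates the
pair `(a, b)` simultaneously for two given quadratic forms. -/
theorem exists_unit_add_le_and_add_le {n : QuadraticForm ℝ E} (hn : n.PosDef)
    (P Q : QuadraticForm ℝ E) {a b : E} (hab : n a + n b = 1) :
    ∃ c, n c = 1 ∧ P a + P b ≤ P c ∧ Q a + Q b ≤ Q c := by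
  set p := P a + P b with hp
  set q := Q a + Q b with hq
  suffices h : ∃ x, x ≠ 0 ∧ p * n x ≤ P x ∧ q * n x ≤ Q x by
    obtain ⟨x, hx, hPx, hQx⟩ := h
    have hnx := hn x hx
    have hs : (√(n x))⁻¹ * (√(n x))⁻¹ = (n x)⁻¹ := by
      rw [← mul_inv, Real.mul_self_sqrt hnx.le]
    refine ⟨(√(n x))⁻¹ • x, ?_, ?_, ?_⟩ <;>
      rw [QuadraticMap.map_smul, hs, smul_eq_mul]
    · exact inv_mul_cancel₀ hnx.ne'
    · rwa [le_inv_mul_iff₀ hnx, mul_comm]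
    · rwa [le_inv_mul_iff₀ hnx, mul_comm]
  have hN : ∀ x, ((P - p • n) - (Q - q • n)) x = (P x - p * n x) - (Q x - q * n x) := by
    intro x
    simp
  obtain ⟨θ, hθ⟩ := exists_rotation_apply_eq_zero ((P - p • n) - (Q - q • n))
    (a := a) (b := b) (by rw [hN, hN]; linear_combination (q - p) * hab - hp + hq)
  have hn' := apply_rotation_add n θ a b
  have hP' := apply_rotation_add P θ a b
  have hQ' := apply_rotation_add Q θ a b
  rw [hN] at hθ
  generalize Real.cos θ • a + Real.sin θ • b = x at hn' hP' hQ' hθ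
  generalize (-Real.sin θ) • a + Real.cos θ • b = y at hn' hP' hQ'
  rw [hab] at hn'
  rw [← hp] at hP'
  rw [← hq] at hQ'
  have hPs : (P x - p * n x) + (P y - p * n y) = 0 := by linear_combination hP' - p * hn'
  have hQs : (Q x - q * n x) + (Q y - q * n y) = 0 := by linear_combination hQ' - q * hn'
  by_cases hx : x = 0
  · subst hx
    refine ⟨y, ?_, ?_, ?_⟩
    · rintro rfl
      simp at hn'
    · simp at hPs; linarith
    · simp at hQs; linarith
  by_cases hy : y = 0
  · subst hy
    refine ⟨x, hx, ?_, ?_⟩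
    · simp at hPs; linarith
    · simp at hQs; linarith
  rcases le_total 0 (P x - p * n x) with h | h
  · exact ⟨x, hx, by linarith, by linarith⟩
  · exact ⟨y, hy, by linarith, by linarith⟩

end QuadraticMap

/-- Existence of a single combining direction (inequality (eq:gamma) in the
proof of Theorem 1(c)): for diagonal matrices `Σ = diag(s)`, `Ω = diag(t)`, an
orthogonal matrix `Φ`, and vectors `a, b` with `‖a‖² + ‖b‖² = 1`, there is a
unit vector `c` with `‖Σc‖² ≥ ‖Σa‖² + ‖Σb‖²` and
`‖ΩΦᵀc‖² ≥ ‖ΩΦᵀa‖² + ‖ΩΦᵀb‖²`. -/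
theorem exists_single_combining_direction
    (m : ℕ) (hm : 1 ≤ m) (s t : Fin m → ℝ)
    (Φ : Matrix (Fin m) (Fin m) ℝ) (hΦ : Φ.transpose * Φ = 1)
    (a b : Fin m → ℝ) (hab : ∑ j, a j ^ 2 + ∑ j, b j ^ 2 = 1) :
    ∃ c : Fin m → ℝ,
      (∑ j, c j ^ 2 = 1) ∧
      (∑ j, s j ^ 2 * a j ^ 2 + ∑ j, s j ^ 2 * b j ^ 2
        ≤ ∑ j, s j ^ 2 * c j ^ 2) ∧
      (∑ j, t j ^ 2 * (∑ i, Φ i j * a i) ^ 2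
          + ∑ j, t j ^ 2 * (∑ i, Φ i j * b i) ^ 2
        ≤ ∑ j, t j ^ 2 * (∑ i, Φ i j * c i) ^ 2) := by
  have hw (w x : Fin m → ℝ) :
      QuadraticMap.weightedSumSquares ℝ w x = ∑ j, w j * x j ^ 2 := by
    simp [QuadraticMap.weightedSumSquares_apply, sq]
  have hpos : (QuadraticMap.weightedSumSquares ℝ (1 : Fin m → ℝ)).PosDef := by
    intro x hx
    obtain ⟨j, hj⟩ := Function.ne_iff.mp hx
    rw [hw]
    refine Finset.sum_pos' (fun i _ => by simpa using sq_nonneg (x i))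
      ⟨j, Finset.mem_univ j, by simpa using pow_pos (abs_pos.mpr hj) 2⟩
  obtain ⟨c, h1, h2, h3⟩ := QuadraticMap.exists_unit_add_le_and_add_le hpos
    (QuadraticMap.weightedSumSquares ℝ fun j => s j ^ 2)
    ((QuadraticMap.weightedSumSquares ℝ fun j => t j ^ 2).comp Φ.transpose.mulVecLin)
    (a := a) (b := b) (by simpa [hw] using hab)
  exact ⟨c, by simpa [hw] using h1, by simpa only [hw] using h2,
    by simpa only [QuadraticMap.comp_apply, hw, Matrix.mulVecLin_apply, Matrix.mulVec, dotProduct,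
      Matrix.transpose_apply] using h3⟩
end

section
/- Two-dimensional combining step (Appendix B, m = 2 case of inequality (eq:gamma)): Let Φ be a 2 × 2 real orthogonal matrix with entries Φ(i,j), let s₁, s₂, t₁, t₂ ∈ ℝ, and let a = (a₁,a₂), b = (b₁,b₂) ∈ ℝ². Define G(x) = s₁²·x₁² + s₂²·x₂² and F(x) = t₁²·(Φ(1,1)·x₁ + Φ(2,1)·x₂)² + t₂²·(Φ(1,2)·x₁ + Φ(2,2)·x₂)², and set c₊ = (√(a₁²+b₁²), √(a₂²+b₂²)) and c₋ = (√(a₁²+b₁²), −√(a₂²+b₂²)). Then (F(a) + F(b) − F(c₊))·(F(a) + F(b) − F(c₋)) = −4·(a₁·b₂ − a₂·b₁)²·(Φ(1,1)·Φ(2,1)·t₁² + Φ(1,2)·Φ(2,2)·t₂²)² ≤ 0; consequently there exists c ∈ {c₊, c₋} with ∑_j c_j² = a₁² + a₂² + b₁² + b₂², G(c) = G(a) + G(b), and F(c) ≥ F(a) + F(b). -/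
/-- Two-dimensional combining step (Appendix B, m = 2 case of inequality
(eq:gamma)): with `G(x) = s₁²x₁² + s₂²x₂²`,
`F(x) = t₁²(Φ₁₁x₁ + Φ₂₁x₂)² + t₂²(Φ₁₂x₁ + Φ₂₂x₂)²`, and the two candidate
vectors `c₊, c₋`, the product `(F(a)+F(b)-F(c₊))·(F(a)+F(b)-F(c₋))` equals
`-4(a₁b₂-a₂b₁)²(Φ₁₁Φ₂₁t₁² + Φ₁₂Φ₂₂t₂²)² ≤ 0`; hence one of `c₊, c₋` preserves
the norm and the value of `G` while not decreasing `F`. -/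
theorem two_dimensional_combining_step
    (Φ : Matrix (Fin 2) (Fin 2) ℝ) (hΦ : Φ.transpose * Φ = 1)
    (s₁ s₂ t₁ t₂ a₁ a₂ b₁ b₂ : ℝ)
    (G F : ℝ × ℝ → ℝ)
    (hG : ∀ x : ℝ × ℝ, G x = s₁ ^ 2 * x.1 ^ 2 + s₂ ^ 2 * x.2 ^ 2)
    (hF : ∀ x : ℝ × ℝ, F x = t₁ ^ 2 * (Φ 0 0 * x.1 + Φ 1 0 * x.2) ^ 2
        + t₂ ^ 2 * (Φ 0 1 * x.1 + Φ 1 1 * x.2) ^ 2)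
    (cp cm : ℝ × ℝ)
    (hcp : cp = (Real.sqrt (a₁ ^ 2 + b₁ ^ 2), Real.sqrt (a₂ ^ 2 + b₂ ^ 2)))
    (hcm : cm = (Real.sqrt (a₁ ^ 2 + b₁ ^ 2), - Real.sqrt (a₂ ^ 2 + b₂ ^ 2))) :
    ((F (a₁, a₂) + F (b₁, b₂) - F cp) * (F (a₁, a₂) + F (b₁, b₂) - F cm)
      = -4 * (a₁ * b₂ - a₂ * b₁) ^ 2
          * (Φ 0 0 * Φ 1 0 * t₁ ^ 2 + Φ 0 1 * Φ 1 1 * t₂ ^ 2) ^ 2) ∧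
    ((F (a₁, a₂) + F (b₁, b₂) - F cp) * (F (a₁, a₂) + F (b₁, b₂) - F cm) ≤ 0) ∧
    ∃ c ∈ ({cp, cm} : Set (ℝ × ℝ)),
      c.1 ^ 2 + c.2 ^ 2 = a₁ ^ 2 + a₂ ^ 2 + b₁ ^ 2 + b₂ ^ 2 ∧
      G c = G (a₁, a₂) + G (b₁, b₂) ∧
      F (a₁, a₂) + F (b₁, b₂) ≤ F c := by
  set p := Real.sqrt (a₁ ^ 2 + b₁ ^ 2)
  set q := Real.sqrt (a₂ ^ 2 + b₂ ^ 2)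
  have hp : p ^ 2 = a₁ ^ 2 + b₁ ^ 2 := Real.sq_sqrt (by positivity)
  have hq : q ^ 2 = a₂ ^ 2 + b₂ ^ 2 := Real.sq_sqrt (by positivity)
  set K := Φ 0 0 * Φ 1 0 * t₁ ^ 2 + Φ 0 1 * Φ 1 1 * t₂ ^ 2 with hK
  have hFp : F (a₁, a₂) + F (b₁, b₂) - F cp = 2 * K * (a₁ * a₂ + b₁ * b₂ - p * q) := by
    simp only [hF, hcp, hK]
    linear_combination (-(t₁ ^ 2 * Φ 0 0 ^ 2 + t₂ ^ 2 * Φ 0 1 ^ 2)) * hp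
      - (t₁ ^ 2 * Φ 1 0 ^ 2 + t₂ ^ 2 * Φ 1 1 ^ 2) * hq
  have hFm : F (a₁, a₂) + F (b₁, b₂) - F cm = 2 * K * (a₁ * a₂ + b₁ * b₂ + p * q) := by
    simp only [hF, hcm, hK]
    linear_combination (-(t₁ ^ 2 * Φ 0 0 ^ 2 + t₂ ^ 2 * Φ 0 1 ^ 2)) * hp
      - (t₁ ^ 2 * Φ 1 0 ^ 2 + t₂ ^ 2 * Φ 1 1 ^ 2) * hq
  have hprod : (F (a₁, a₂) + F (b₁, b₂) - F cp) * (F (a₁, a₂) + F (b₁, b₂) - F cm)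
      = -4 * (a₁ * b₂ - a₂ * b₁) ^ 2 * K ^ 2 := by
    rw [hFp, hFm]
    linear_combination (-4 * K ^ 2 * q ^ 2) * hp - 4 * K ^ 2 * (a₁ ^ 2 + b₁ ^ 2) * hq
  have hnonpos :
      (F (a₁, a₂) + F (b₁, b₂) - F cp) * (F (a₁, a₂) + F (b₁, b₂) - F cm) ≤ 0 := by
    rw [hprod]
    nlinarith [sq_nonneg ((a₁ * b₂ - a₂ * b₁) * K)]
  refine ⟨hprod, hnonpos, ?_⟩
  rcases mul_nonpos_iff.mp hnonpos with ⟨-, h⟩ | ⟨h, -⟩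
  · refine ⟨cm, by simp, ?_, ?_, sub_nonpos.mp h⟩
    · simp only [hcm]
      linear_combination hp + hq
    · simp only [hG, hcm]
      linear_combination s₁ ^ 2 * hp + s₂ ^ 2 * hq
  · refine ⟨cp, by simp, ?_, ?_, sub_nonpos.mp h⟩
    · simp only [hcp]
      linear_combination hp + hq
    · simp only [hG, hcp]
      linear_combination s₁ ^ 2 * hp + s₂ ^ 2 * hq
end
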